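/- Let n ≥ 1, let σ be a congruence on P_n^Φ, and suppose ((i,α),(j,β)) ∈ σ with α ∈ D_q, β ∈ D_r, q ≥ r, q ≥ 2, and α not H-related to β in P_n. Then I_{qi} ∪ I_{rj} ⊆ I(σ), where I(σ) is the union of all ideals I of P_n^Φ with R_I ⊆ σ. -/

import Mathlib

namespace TPM

/-- Vertex set `{1,…,n} ∪ {1',…,n'}`: `Sum.inl` = unprimed (upper row),
`Sum.inr` = primed (lower row). -/
abbrev V (n : ℕ) := Fin n ⊕ Fin n

/-- The partition monoid `P_n`: set partitions of the `2n`-element set `V n`,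
encoded as equivalence relations (setoids). -/
abbrev PM (n : ℕ) := Setoid (V n)

/-- Three-row vertex set of the product graph: top / middle / bottom. -/
abbrev W (n : ℕ) := Fin n ⊕ (Fin n ⊕ Fin n)

variable {n : ℕ}

/-- First factor: unprimed ↦ top, primed ↦ middle. -/
def topMid : V n → W n
  | Sum.inl i => Sum.inl i
  | Sum.inr i => Sum.inr (Sum.inl i)

/-- Second factor: unprimed ↦ middle, primed ↦ bottom. -/
def midBot : V n → W n
  | Sum.inl i => Sum.inr (Sum.inl i)
  | Sum.inr i => Sum.inr (Sum.inr i)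

/-- Embedding of `V n` as top and bottom rows of the three-row set. -/
def topBot : V n → W n
  | Sum.inl i => Sum.inl i
  | Sum.inr i => Sum.inr (Sum.inr i)

/-- Edge relation of the product graph `Γ(α,β)`. -/
def graphRel (α β : PM n) (x y : W n) : Prop :=
  (∃ u v : V n, α.r u v ∧ x = topMid u ∧ y = topMid v) ∨
  (∃ u v : V n, β.r u v ∧ x = midBot u ∧ y = midBot v)

/-- Connectivity (equivalence closure of the edge relation) in `Γ(α,β)`. -/
def conn (α β : PM n) : W n → W n → Prop := Relation.EqvGen (graphRel α β)

/-- Connectivity in `Γ(α,β)`, as a setoid on the three-row vertex set. -/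
def connSetoid (α β : PM n) : Setoid (W n) :=
  ⟨conn α β, Relation.EqvGen.is_equivalence _⟩

/-- The product of two partitions: `x,y` lie in the same block of `αβ` iff they are
connected in `Γ(α,β)`. -/
def pmul (α β : PM n) : PM n :=
  ⟨fun x y => conn α β (topBot x) (topBot y),
    ⟨fun _ => Relation.EqvGen.refl _, fun h => Relation.EqvGen.symm _ _ h, fun h h' => Relation.EqvGen.trans _ _ _ h h'⟩⟩

/-- A vertex of the three-row set lies in the middle row. -/
def isMid (x : W n) : Prop := ∃ i : Fin n, x = Sum.inr (Sum.inl i)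

/-- `Φ(α,β)`: the number of floating components of `Γ(α,β)`, i.e. connected components
all of whose vertices lie in the middle row. -/
noncomputable def Phi (α β : PM n) : ℕ :=
  Nat.card {c : Quotient (connSetoid α β) //
    ∀ x : W n, Quotient.mk (connSetoid α β) x = c → isMid x}

/-- The rank of a partition: the number of transversal blocks (blocks containing both an
unprimed and a primed element). -/
noncomputable def rnk (α : PM n) : ℕ :=
  Nat.card {c : Quotient α //
    (∃ i : Fin n, Quotient.mk α (Sum.inl i) = c) ∧ ∃ i : Fin n, Quotient.mk α (Sum.inr i) = c}

/-- Which row of `V n` a point lies in. -/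
def side : V n → Bool
  | Sum.inl _ => true
  | Sum.inr _ => false

/-- `α̂`: split each transversal of `α` into its unprimed part and its primed part. -/
def hat (α : PM n) : PM n :=
  ⟨fun x y => α.r x y ∧ side x = side y,
    ⟨fun x => ⟨α.iseqv.refl x, rfl⟩,
     fun h => ⟨α.iseqv.symm h.1, h.2.symm⟩,
     fun h h' => ⟨α.iseqv.trans h.1 h'.1, h.2.trans h'.2⟩⟩⟩

/-- The twisted product on `ℕ × P_n`:  `(i,α)(j,β) = (i + j + Φ(α,β), αβ)`. -/
noncomputable def tmul (a b : ℕ × PM n) : ℕ × PM n :=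
  (a.1 + b.1 + Phi a.2 b.2, pmul a.2 b.2)

/-- A congruence on a set equipped with a binary operation: an equivalence relation
compatible with the operation on both sides. -/
def IsCongruence {M : Type*} (mul : M → M → M) (σ : M → M → Prop) : Prop :=
  Equivalence σ ∧ ∀ x y a, σ x y → σ (mul a x) (mul a y) ∧ σ (mul x a) (mul y a)

/-- Green's relation `R`: equality of the right ideals `xM = yM`. -/
def greenR {M : Type*} (mul : M → M → M) (x y : M) : Prop :=
  Set.range (mul x) = Set.range (mul y)

/-- Green's relation `L`: `Mx = My`. -/
def greenL {M : Type*} (mul : M → M → M) (x y : M) : Prop :=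
  Set.range (fun a => mul a x) = Set.range (fun a => mul a y)

/-- The principal two-sided ideal `MxM`. -/
def jSet {M : Type*} (mul : M → M → M) (x : M) : Set M :=
  Set.range (fun p : M × M => mul (mul p.1 x) p.2)

/-- Green's relation `J`: `MxM = MyM`. -/
def greenJ {M : Type*} (mul : M → M → M) (x y : M) : Prop :=
  jSet mul x = jSet mul y

/-- Green's relation `H = R ∩ L`. -/
def greenH {M : Type*} (mul : M → M → M) (x y : M) : Prop :=
  greenR mul x y ∧ greenL mul x y

/-- Green's relation `D = R ∘ L`. -/
def greenD {M : Type*} (mul : M → M → M) (x y : M) : Prop :=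
  ∃ z, greenR mul x z ∧ greenL mul z y

/-- `pd(α,β)` satisfies `P`, where `α` has `p` transversals: there are representatives
`a s` of the upper parts of the `p` (pairwise distinct) transversals of `α`, with `b s`
representing the corresponding lower parts, and a permutation `π` with `P π` such that the
block of `β` containing `a s` contains `b (π s)`.  (For H-related `α, β ∈ D_p` this says
exactly that some representation of the permutational difference `pd(α,β)` satisfies `P`.) -/
def pdIn (p : ℕ) (P : Equiv.Perm (Fin p) → Prop) (α β : PM n) : Prop :=
  ∃ (a b : Fin p → Fin n) (π : Equiv.Perm (Fin p)),
    (∀ s t, α.r (Sum.inl (a s)) (Sum.inl (a t)) → s = t) ∧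
    (∀ s, α.r (Sum.inl (a s)) (Sum.inr (b s))) ∧
    (∀ s, β.r (Sum.inl (a s)) (Sum.inr (b (π s)))) ∧
    P π

/-- The relation `ν_N` on `D_p`, for a subgroup `N ≤ S_p`:  H-related pairs of rank-`p`
partitions whose permutational difference lies in `N`. -/
def nuRel (p : ℕ) (N : Subgroup (Equiv.Perm (Fin p))) (α β : PM n) : Prop :=
  rnk α = p ∧ rnk β = p ∧ greenH pmul α β ∧ pdIn p (· ∈ N) α β

/-- The congruence `(m, m+d)^♯` on the additive monoid `ℕ` (intended for `d ≥ 1`). -/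
def natCong (m d : ℕ) (i j : ℕ) : Prop :=
  i = j ∨ (m ≤ i ∧ m ≤ j ∧ i % d = j % d)

/-- `min θ ≤ i` for a congruence `θ` on `ℕ` (with `min Δ_ℕ = ∞`). -/
def minLE (θ : ℕ → ℕ → Prop) (i : ℕ) : Prop :=
  ∃ a b, θ a b ∧ a ≠ b ∧ a ≤ i

/-- `k ≤ min θ` for a congruence `θ` on `ℕ` (with `min Δ_ℕ = ∞`). -/
def leMin (k : ℕ) (θ : ℕ → ℕ → Prop) : Prop :=
  ∀ a b, θ a b → a ≠ b → k ≤ a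

/-- The possible entries of a C-matrix. -/
inductive CEntry : Type
  | delta | muUp | muDown | mu | lam | rho | R
  | nsym (q : ℕ) (N : Subgroup (Equiv.Perm (Fin q)))

/-- Whether a C-matrix entry is an N-symbol. -/
def isNsym : CEntry → Prop
  | CEntry.nsym _ _ => True
  | _ => False

/-- The allowed values of the symbol `ζ` in row types RT2, RT5, RT6. -/
def isZeta (e : CEntry) : Prop :=
  e = CEntry.mu ∨ e = CEntry.muUp ∨ e = CEntry.muDown ∨ e = CEntry.delta

/-- The allowed values of the symbol `ξ` in row types RT4–RT7: any of `μ,ρ,λ,R` if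
`d = 1`, and only `μ` if `d > 1`. -/
def xiOK (d : ℕ) (e : CEntry) : Prop :=
  e = CEntry.mu ∨ (d = 1 ∧ (e = CEntry.rho ∨ e = CEntry.lam ∨ e = CEntry.R))

/-- Row type RT1 for rows 0 and 1: all entries `Δ`. -/
def RT1 (M0 M1 : ℕ → CEntry) : Prop :=
  (∀ i, M0 i = CEntry.delta) ∧ (∀ i, M1 i = CEntry.delta)

/-- Row type RT2. -/
def RT2 (Θ0 Θ1 : ℕ → ℕ → Prop) (M0 M1 : ℕ → CEntry) : Prop :=
  Θ0 = Eq ∧ Θ1 = Eq ∧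
  ∃ i ζ, isZeta ζ ∧
    (∀ j, j < i → M0 j = CEntry.delta) ∧ (∀ j, i ≤ j → M0 j = CEntry.mu) ∧
    (∀ j, j < i → M1 j = CEntry.delta) ∧ M1 i = ζ ∧ (∀ j, i < j → M1 j = CEntry.mu)

/-- Row type RT3. -/
def RT3 (Θ0 : ℕ → ℕ → Prop) (M0 M1 : ℕ → CEntry) : Prop :=
  ∃ m ξ, Θ0 = natCong m 1 ∧ (ξ = CEntry.rho ∨ ξ = CEntry.lam ∨ ξ = CEntry.R) ∧
    (∀ i, M1 i = CEntry.delta) ∧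
    (∀ j, j < m → M0 j = CEntry.delta) ∧ (∀ j, m ≤ j → M0 j = ξ)

/-- Row type RT4. -/
def RT4 (Θ0 Θ1 : ℕ → ℕ → Prop) (M0 M1 : ℕ → CEntry) : Prop :=
  ∃ m d ξ, 1 ≤ d ∧ Θ0 = natCong m d ∧ Θ1 = natCong m d ∧ xiOK d ξ ∧
    (∀ j, j < m → M0 j = CEntry.delta ∧ M1 j = CEntry.delta) ∧
    (∀ j, m ≤ j → M0 j = ξ ∧ M1 j = ξ)

/-- Row type RT5. -/
def RT5 (Θ0 Θ1 : ℕ → ℕ → Prop) (M0 M1 : ℕ → CEntry) : Prop :=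
  ∃ m d i ξ ζ, 1 ≤ d ∧ i < m ∧ Θ0 = natCong m d ∧ Θ1 = natCong (m + 1) d ∧
    xiOK d ξ ∧ isZeta ζ ∧
    (∀ j, j < i → M0 j = CEntry.delta) ∧ (∀ j, i ≤ j → j < m → M0 j = CEntry.mu) ∧
    (∀ j, m ≤ j → M0 j = ξ) ∧
    (∀ j, j < i → M1 j = CEntry.delta) ∧ M1 i = ζ ∧
    (∀ j, i < j → j ≤ m → M1 j = CEntry.mu) ∧ (∀ j, m < j → M1 j = ξ)

/-- Row type RT6. -/
def RT6 (Θ0 Θ1 : ℕ → ℕ → Prop) (M0 M1 : ℕ → CEntry) : Prop :=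
  ∃ m l d ξ ζ, 1 ≤ d ∧ m < l ∧ Θ0 = natCong m d ∧ Θ1 = natCong l d ∧
    xiOK d ξ ∧ isZeta ζ ∧
    (∀ j, j < m → M0 j = CEntry.delta) ∧ (∀ j, m ≤ j → M0 j = ξ) ∧
    (∀ j, j < l - 1 → M1 j = CEntry.delta) ∧ M1 (l - 1) = ζ ∧ (∀ j, l ≤ j → M1 j = ξ)

/-- Row type RT7. -/
def RT7 (Θ0 Θ1 : ℕ → ℕ → Prop) (M0 M1 : ℕ → CEntry) : Prop :=
  ∃ m l d ξ, 1 ≤ d ∧ 0 < m ∧ m + 1 < l ∧ (l - 1) % d = m % d ∧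
    Θ0 = natCong m d ∧ Θ1 = natCong l d ∧ xiOK d ξ ∧
    (∀ j, j < m - 1 → M0 j = CEntry.delta) ∧ M0 (m - 1) = CEntry.mu ∧
    (∀ j, m ≤ j → M0 j = ξ) ∧
    (∀ j, j < l - 1 → M1 j = CEntry.delta) ∧ M1 (l - 1) = CEntry.mu ∧
    (∀ j, l ≤ j → M1 j = ξ)

/-- Row type RT8 for a row `q ≥ 2`: all entries `Δ`. -/
def RT8 (Mq : ℕ → CEntry) : Prop := ∀ i, Mq i = CEntry.delta

/-- Row type RT9 for a row `q ≥ 2`. -/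
def RT9 (q : ℕ) (Θq : ℕ → ℕ → Prop) (Mq : ℕ → CEntry) : Prop :=
  ∃ (i k : ℕ) (Ns : ℕ → Subgroup (Equiv.Perm (Fin q))),
    i ≤ k ∧ leMin k Θq ∧
    (∀ j, i ≤ j → j ≤ k → Ns j ≠ ⊥ ∧ (Ns j).Normal) ∧
    (∀ j j', i ≤ j → j ≤ j' → j' ≤ k → Ns j ≤ Ns j') ∧
    (∀ j, j < i → Mq j = CEntry.delta) ∧
    (∀ j, i ≤ j → j < k → Mq j = CEntry.nsym q (Ns j)) ∧
    (∀ j, k ≤ j → Mq j = CEntry.nsym q (Ns k))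

/-- Row type RT10 for a row `q ≥ 2`. -/
def RT10 (q : ℕ) (Θq : ℕ → ℕ → Prop) (Mq : ℕ → CEntry) : Prop :=
  ∃ (i m : ℕ) (Ns : ℕ → Subgroup (Equiv.Perm (Fin q))),
    i ≤ m ∧ Θq = natCong m 1 ∧
    (∀ j, i ≤ j → j < m → Ns j ≠ ⊥ ∧ (Ns j).Normal) ∧
    (∀ j j', i ≤ j → j ≤ j' → j' < m → Ns j ≤ Ns j') ∧
    (∀ j, j < i → Mq j = CEntry.delta) ∧
    (∀ j, i ≤ j → j < m → Mq j = CEntry.nsym q (Ns j)) ∧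
    (∀ j, m ≤ j → Mq j = CEntry.R)

/-- A C-pair for `P_n^Φ`: a descending chain `Θ = (θ_0 ⊇ ⋯ ⊇ θ_n)` of congruences on
`(ℕ,+)` together with a matrix `M = (M_{qi})`, `0 ≤ q ≤ n`, `i ∈ ℕ`, whose rows 0 and 1
jointly have one of the types RT1–RT7, whose rows `q ≥ 2` have one of the types RT8–RT10,
and which satisfies the verticality conditions (V1) and (V2). -/
def IsCPair (n : ℕ) (Θ : ℕ → ℕ → ℕ → Prop) (M : ℕ → ℕ → CEntry) : Prop :=
  (∀ q, q ≤ n → IsCongruence (· + ·) (Θ q)) ∧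
  (∀ q r, q ≤ r → r ≤ n → ∀ i j, Θ r i j → Θ q i j) ∧
  (RT1 (M 0) (M 1) ∨ RT2 (Θ 0) (Θ 1) (M 0) (M 1) ∨ RT3 (Θ 0) (M 0) (M 1) ∨
    RT4 (Θ 0) (Θ 1) (M 0) (M 1) ∨ RT5 (Θ 0) (Θ 1) (M 0) (M 1) ∨
    RT6 (Θ 0) (Θ 1) (M 0) (M 1) ∨ RT7 (Θ 0) (Θ 1) (M 0) (M 1)) ∧
  (∀ q, 2 ≤ q → q ≤ n → (RT8 (M q) ∨ RT9 q (Θ q) (M q) ∨ RT10 q (Θ q) (M q))) ∧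
  (∀ q i, 1 ≤ q → q ≤ n → isNsym (M q i) →
    ¬(M (q - 1) i = CEntry.delta ∨ M (q - 1) i = CEntry.muUp ∨
      M (q - 1) i = CEntry.muDown ∨ isNsym (M (q - 1) i))) ∧
  (∀ q i, 2 ≤ q → q ≤ n → M q i = CEntry.R → M (q - 1) i = CEntry.R)

/-- The relation `cg(Θ,M)` on `P_n^Φ` associated with a C-pair `(Θ,M)`: conditions
(C1)–(C8). -/
def cg (n : ℕ) (Θ : ℕ → ℕ → ℕ → Prop) (M : ℕ → ℕ → CEntry)
    (a b : ℕ × PM n) : Prop :=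
  -- (C1)
  (M (rnk a.2) a.1 = CEntry.delta ∧ M (rnk b.2) b.1 = CEntry.delta ∧
    Θ (rnk a.2) a.1 b.1 ∧ a.2 = b.2) ∨
  -- (C2)
  (M (rnk a.2) a.1 = CEntry.R ∧ M (rnk b.2) b.1 = CEntry.R) ∨
  -- (C3)
  (∃ p N, M (rnk a.2) a.1 = CEntry.nsym p N ∧ M (rnk b.2) b.1 = CEntry.nsym p N ∧
    Θ (rnk a.2) a.1 b.1 ∧ rnk a.2 = p ∧ greenH pmul a.2 b.2 ∧ pdIn p (· ∈ N) a.2 b.2) ∨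
  -- (C4)
  (M (rnk a.2) a.1 = CEntry.lam ∧ M (rnk b.2) b.1 = CEntry.lam ∧
    greenL pmul (hat a.2) (hat b.2)) ∨
  -- (C5)
  (M (rnk a.2) a.1 = CEntry.rho ∧ M (rnk b.2) b.1 = CEntry.rho ∧
    greenR pmul (hat a.2) (hat b.2)) ∨
  -- (C6)
  (M (rnk a.2) a.1 = CEntry.muDown ∧ M (rnk b.2) b.1 = CEntry.muDown ∧
    hat a.2 = hat b.2 ∧ greenL pmul a.2 b.2) ∨
  -- (C7)
  (M (rnk a.2) a.1 = CEntry.muUp ∧ M (rnk b.2) b.1 = CEntry.muUp ∧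
    hat a.2 = hat b.2 ∧ greenR pmul a.2 b.2) ∨
  -- (C8)
  (M (rnk a.2) a.1 = CEntry.mu ∧ M (rnk b.2) b.1 = CEntry.mu ∧
    hat a.2 = hat b.2 ∧
    ((rnk a.2 = rnk b.2 ∧ Θ (rnk a.2) a.1 b.1) ∨
     (rnk a.2 ≠ rnk b.2 ∧ Θ 0 (a.1 + rnk b.2) (b.1 + rnk a.2) ∧
        ¬ minLE (Θ (rnk a.2)) a.1 ∧ ¬ minLE (Θ (rnk b.2)) b.1) ∨
     (rnk a.2 ≠ rnk b.2 ∧ Θ 0 (a.1 + rnk b.2) (b.1 + rnk a.2) ∧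
        minLE (Θ (rnk a.2)) a.1 ∧ minLE (Θ (rnk b.2)) b.1)))

/-- The C-pair `(Θ,M)` is exceptional with exceptional row `q`, where
`θ_q = (m, m+2d)^♯`. -/
def ExcAt (n : ℕ) (Θ : ℕ → ℕ → ℕ → Prop) (M : ℕ → ℕ → CEntry) (q m d : ℕ) : Prop :=
  2 ≤ q ∧ q ≤ n ∧ 1 ≤ d ∧ Θ q = natCong m (2 * d) ∧
  ((2 < q ∧ M q m = CEntry.nsym q (alternatingGroup (Fin q))) ∨
   (q = 2 ∧ M 2 m = CEntry.delta ∧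
     (M 1 m = CEntry.mu ∨ M 1 m = CEntry.rho ∨ M 1 m = CEntry.lam ∨ M 1 m = CEntry.R) ∧
     (∀ i j, natCong m d i j → Θ 1 i j)))

/-- The exceptional congruence `cgx(Θ,M)` associated with an exceptional C-pair:
`cg(Θ,M)` together with the pairs of (C9). -/
def cgx (n : ℕ) (Θ : ℕ → ℕ → ℕ → Prop) (M : ℕ → ℕ → CEntry) (q m d : ℕ)
    (a b : ℕ × PM n) : Prop :=
  cg n Θ M a b ∨
  (rnk a.2 = q ∧ rnk b.2 = q ∧ natCong m d a.1 b.1 ∧ ¬ Θ q a.1 b.1 ∧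
    greenH pmul a.2 b.2 ∧ pdIn q (fun π => π ∉ alternatingGroup (Fin q)) a.2 b.2)

/-- The Rees relation of a subset `I`. -/
def rees {M : Type*} (I : Set M) (x y : M) : Prop := x = y ∨ (x ∈ I ∧ y ∈ I)

/-- A (possibly empty) ideal of `P_n^Φ`: `MIM ⊆ I`. -/
def tIdeal (n : ℕ) (I : Set (ℕ × PM n)) : Prop :=
  ∀ a b x, x ∈ I → tmul (tmul a x) b ∈ I

/-- `I(σ)`: the union of all ideals `I` of `P_n^Φ` whose Rees congruence is contained
in `σ`. -/
def Isig (n : ℕ) (σ : (ℕ × PM n) → (ℕ × PM n) → Prop) : Set (ℕ × PM n) :=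
  ⋃₀ {I | tIdeal n I ∧ ∀ x y, rees I x y → σ x y}

/-- The 0-twisted partition monoid `P_{n,0}^Φ`, carried by `Option (P_n)` with
`none` the zero element `✗`. -/
noncomputable def mul0 (a b : Option (PM n)) : Option (PM n) :=
  match a, b with
  | some α, some β => if Phi α β = 0 then some (pmul α β) else none
  | _, _ => none

/-- `rank a ≤ q`, where `rank ✗ = -∞`. -/
def rnkLE (a : Option (PM n)) (q : ℕ) : Prop :=
  ∀ α, a = some α → rnk α ≤ q

/-- The Rees congruence `R_q` on `P_{n,0}^Φ`. -/
def ReesQ (q : ℕ) (a b : Option (PM n)) : Prop :=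
  a = b ∨ (rnkLE a q ∧ rnkLE b q)

/-- Lift a relation on `P_n` to `P_{n,0}^Φ = P_n ∪ {✗}`. -/
def lift2 (r : PM n → PM n → Prop) (a b : Option (PM n)) : Prop :=
  ∃ α β, a = some α ∧ b = some β ∧ r α β



theorem conn_l {α : PM n} (β : PM n) {x y : V n} (h : α x y) : conn α β (topMid x) (topMid y) :=
  Relation.EqvGen.rel _ _ (Or.inl ⟨x, y, h, rfl, rfl⟩)

theorem conn_r (α : PM n) {β : PM n} {x y : V n} (h : β x y) : conn α β (midBot x) (midBot y) :=
  Relation.EqvGen.rel _ _ (Or.inr ⟨x, y, h, rfl, rfl⟩)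

theorem conn_refl (α β : PM n) (x : W n) : conn α β x x := Relation.EqvGen.refl _

theorem conn_symm {α β : PM n} {x y : W n} (h : conn α β x y) : conn α β y x :=
  Relation.EqvGen.symm _ _ h

theorem conn_trans {α β : PM n} {x y z : W n} (h : conn α β x y) (h' : conn α β y z) :
    conn α β x z := Relation.EqvGen.trans _ _ _ h h'

theorem conn_le {α β : PM n} (K : Setoid (W n))
    (h1 : ∀ x y, α x y → K (topMid x) (topMid y))
    (h2 : ∀ x y, β x y → K (midBot x) (midBot y)) {x y : W n} (h : conn α β x y) : K x y := by
  induction h with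
  | rel x y h =>
    rcases h with ⟨u, v, h, rfl, rfl⟩ | ⟨u, v, h, rfl, rfl⟩
    · exact h1 _ _ h
    · exact h2 _ _ h
  | refl x => exact K.refl' x
  | symm x y _ ih => exact K.symm' ih
  | trans x y z _ _ ih1 ih2 => exact K.trans' ih1 ih2

theorem conn_label {α β : PM n} {L : Type*} (f : W n → L)
    (h1 : ∀ x y, α x y → f (topMid x) = f (topMid y))
    (h2 : ∀ x y, β x y → f (midBot x) = f (midBot y)) {x y : W n} (h : conn α β x y) :
    f x = f y :=
  conn_le (Setoid.ker f) h1 h2 h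

theorem Phi_zero {α β : PM n}
    (h : ∀ m : Fin n, ∃ v : V n, conn α β (Sum.inr (Sum.inl m)) (topBot v)) : Phi α β = 0 := by
  unfold Phi
  rw [Nat.card_eq_zero]
  left
  refine ⟨?_⟩
  rintro ⟨c, hc⟩
  induction c using Quotient.inductionOn with
  | h x =>
    obtain ⟨m, rfl⟩ := hc x rfl
    obtain ⟨v, hv⟩ := h m
    obtain ⟨k, hk⟩ := hc (topBot v) (Quotient.sound (conn_symm hv))
    cases v <;> simp [topBot] at hk

/-- Partition with prescribed labels. -/
def EE {K : Type*} (c d : Fin n → K) (θ : Setoid K) : PM n := Setoid.comap (Sum.elim c d) θ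

theorem EE_mul {K : Type*} (c d e : Fin n → K) (hd : Function.Surjective d)
    (he : Function.Surjective e) (θ θ' : Setoid K) :
    pmul (EE c d θ) (EE d e θ') = EE c e (θ ⊔ θ') ∧ Phi (EE c d θ) (EE d e θ') = 0 := by
  let f : W n → K := Sum.elim c (Sum.elim d e)
  have key : ∀ k l, (θ ⊔ θ') k l → ∀ y z, d y = k → d z = l →
      conn (EE c d θ) (EE d e θ') (Sum.inr (Sum.inl y)) (Sum.inr (Sum.inl z)) := by
    intro k l h
    let R : Setoid K := ⟨fun k l => ∀ y z, d y = k → d z = l →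
      conn (EE c d θ) (EE d e θ') (Sum.inr (Sum.inl y)) (Sum.inr (Sum.inl z)), ?_, ?_, ?_⟩
    · have h1 : θ ⊔ θ' ≤ R := by
        refine sup_le ?_ ?_
        · intro k l h y z hy hz
          refine conn_l (α := EE c d θ) (EE d e θ') (x := Sum.inr y) (y := Sum.inr z) ?_
          subst hy hz; exact h
        · intro k l h y z hy hz
          refine conn_r (EE c d θ) (β := EE d e θ') (x := Sum.inl y) (y := Sum.inl z) ?_
          subst hy hz; exact h
      exact h1 h
    · intro k y z hy hz
      refine conn_l (α := EE c d θ) (EE d e θ') (x := Sum.inr y) (y := Sum.inr z) ?_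
      subst hy
      change θ (d y) (d z)
      rw [hz]
    · intro k l h y z hy hz
      exact conn_symm (h z y hz hy)
    · intro k l m h h' y z hy hz
      obtain ⟨w, hw⟩ := hd l
      exact conn_trans (h y w hy hw) (h' w z hw hz)
  have tm : ∀ x y, c x = d y →
      conn (EE c d θ) (EE d e θ') (Sum.inl x) (Sum.inr (Sum.inl y)) := by
    intro x y h
    refine conn_l (α := EE c d θ) (EE d e θ') (x := Sum.inl x) (y := Sum.inr y) ?_
    change θ (c x) (d y)
    rw [h]
  have bm : ∀ x y, e x = d y →
      conn (EE c d θ) (EE d e θ') (Sum.inr (Sum.inr x)) (Sum.inr (Sum.inl y)) := by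
    intro x y h
    refine conn_r (EE c d θ) (β := EE d e θ') (x := Sum.inr x) (y := Sum.inl y) ?_
    change θ' (e x) (d y)
    rw [h]
  have mm : ∀ v : V n, ∃ y, d y = Sum.elim c e v ∧
      conn (EE c d θ) (EE d e θ') (topBot v) (Sum.inr (Sum.inl y)) := by
    rintro (x | x)
    · obtain ⟨y, hy⟩ := hd (c x)
      exact ⟨y, hy, tm x y hy.symm⟩
    · obtain ⟨y, hy⟩ := hd (e x)
      exact ⟨y, hy, bm x y hy.symm⟩
  constructor
  · ext u v
    constructor
    · intro h
      have := conn_le (Setoid.comap f (θ ⊔ θ')) ?_ ?_ h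
      · rcases u with u | u <;> rcases v with v | v <;> exact this
      · rintro x y h
        have : (θ ⊔ θ') (Sum.elim c d x) (Sum.elim c d y) :=
          (le_sup_left : θ ≤ θ ⊔ θ') h
        rcases x with u | u <;> rcases y with v | v <;> exact this
      · rintro x y h
        have : (θ ⊔ θ') (Sum.elim d e x) (Sum.elim d e y) :=
          (le_sup_right : θ' ≤ θ ⊔ θ') h
        rcases x with u | u <;> rcases y with v | v <;> exact this
    · intro h
      obtain ⟨y, hy, hy'⟩ := mm u
      obtain ⟨z, hz, hz'⟩ := mm v
      exact conn_trans hy' (conn_trans (key _ _ h y z hy hz) (conn_symm hz'))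
  · apply Phi_zero
    intro m
    obtain ⟨x, hx⟩ := he (d m)
    exact ⟨Sum.inr x, conn_symm (bm x m hx)⟩

/-- Flip (anti-involution). -/
def fl (α : PM n) : PM n := Setoid.comap Sum.swap α

theorem fl_fl (α : PM n) : fl (fl α) = α := by
  ext u v
  change α (Sum.swap (Sum.swap u)) (Sum.swap (Sum.swap v)) ↔ _
  simp

def ws : W n → W n
  | Sum.inl i => Sum.inr (Sum.inr i)
  | Sum.inr (Sum.inl i) => Sum.inr (Sum.inl i)
  | Sum.inr (Sum.inr i) => Sum.inl i

theorem ws_ws (x : W n) : ws (ws x) = x := by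
  rcases x with x | x | x <;> rfl

theorem ws_topMid (x : V n) : ws (topMid x) = midBot (Sum.swap x) := by
  rcases x with x | x <;> rfl

theorem ws_midBot (x : V n) : ws (midBot x) = topMid (Sum.swap x) := by
  rcases x with x | x <;> rfl

theorem ws_topBot (x : V n) : ws (topBot x) = topBot (Sum.swap x) := by
  rcases x with x | x <;> rfl

theorem conn_fl {α β : PM n} {x y : W n} (h : conn (fl β) (fl α) x y) :
    conn α β (ws x) (ws y) := by
  refine conn_le (Setoid.comap ws (connSetoid α β)) ?_ ?_ h
  · intro u v h
    change conn α β (ws _) (ws _)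
    rw [ws_topMid, ws_topMid]
    exact conn_r α h
  · intro u v h
    change conn α β (ws _) (ws _)
    rw [ws_midBot, ws_midBot]
    exact conn_l β h

theorem conn_fl_iff {α β : PM n} {x y : W n} :
    conn (fl β) (fl α) x y ↔ conn α β (ws x) (ws y) := by
  refine ⟨conn_fl, fun h => ?_⟩
  have : conn (fl (fl α)) (fl (fl β)) (ws x) (ws y) := by rwa [fl_fl, fl_fl]
  have := conn_fl this
  rwa [ws_ws, ws_ws] at this

theorem pmul_fl (α β : PM n) : pmul (fl β) (fl α) = fl (pmul α β) := by
  ext u v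
  change conn _ _ _ _ ↔ conn _ _ _ _
  rw [conn_fl_iff, ws_topBot, ws_topBot]

def wsEquiv (n : ℕ) : W n ≃ W n := ⟨ws, ws, ws_ws, ws_ws⟩

theorem isMid_ws {x : W n} (h : isMid x) : isMid (ws x) := by
  obtain ⟨i, rfl⟩ := h
  exact ⟨i, rfl⟩

theorem Phi_fl (α β : PM n) : Phi (fl β) (fl α) = Phi α β := by
  unfold Phi
  let e : Quotient (connSetoid (fl β) (fl α)) ≃ Quotient (connSetoid α β) :=
    Quotient.congr (wsEquiv n) (fun x y => conn_fl_iff)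
  refine Nat.card_congr (e.subtypeEquiv ?_)
  intro c
  induction c using Quotient.inductionOn with
  | h z =>
    have he : e (Quotient.mk _ z) = Quotient.mk _ (ws z) := rfl
    rw [he]
    constructor
    · intro h x hx
      have h1 : conn α β x (ws z) := Quotient.exact hx
      have h2 : conn (fl β) (fl α) (ws x) z := by
        rw [conn_fl_iff, ws_ws]; exact h1
      have := isMid_ws (h (ws x) (Quotient.sound h2))
      rwa [ws_ws] at this
    · intro h x hx
      have h1 : conn (fl β) (fl α) x z := Quotient.exact hx
      have h2 : conn α β (ws x) (ws z) := conn_fl h1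
      have := isMid_ws (h (ws x) (Quotient.sound h2))
      rwa [ws_ws] at this

theorem rnk_fl (α : PM n) : rnk (fl α) = rnk α := by
  unfold rnk
  let e : Quotient (fl α) ≃ Quotient α :=
    Quotient.congr (Equiv.sumComm _ _) (fun x y => Iff.rfl)
  refine Nat.card_congr (e.subtypeEquiv ?_)
  intro c
  have h1 : ∀ i, e (Quotient.mk _ (Sum.inl i)) = Quotient.mk _ (Sum.inr i) := fun i => rfl
  have h2 : ∀ i, e (Quotient.mk _ (Sum.inr i)) = Quotient.mk _ (Sum.inl i) := fun i => rfl
  constructor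
  · rintro ⟨⟨a, ha⟩, ⟨b, hb⟩⟩
    exact ⟨⟨b, by rw [← hb, h2]⟩, ⟨a, by rw [← ha, h1]⟩⟩
  · rintro ⟨⟨a, ha⟩, ⟨b, hb⟩⟩
    exact ⟨⟨b, e.injective (by rw [← hb, h1])⟩, ⟨a, e.injective (by rw [← ha, h2])⟩⟩

theorem fl_mono {α β : PM n} (h : α ≤ β) : fl α ≤ fl β := fun _ _ hx => h hx

theorem fl_le {α β : PM n} : fl α ≤ β ↔ α ≤ fl β := by
  constructor
  · intro h
    have := fl_mono h
    rwa [fl_fl] at this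
  · intro h
    have := fl_mono h
    rwa [fl_fl] at this

theorem fl_sup (α β : PM n) : fl (α ⊔ β) = fl α ⊔ fl β := by
  apply le_antisymm
  · rw [fl_le]
    refine sup_le ?_ ?_
    · rw [← fl_le]; exact le_sup_left
    · rw [← fl_le]; exact le_sup_right
  · exact sup_le (fl_mono le_sup_left) (fl_mono le_sup_right)

/-- `θ` on the lower row. -/
def low (θ : Setoid (Fin n)) : PM n :=
  Relation.EqvGen.setoid (fun x y => ∃ a b, θ a b ∧ x = Sum.inr a ∧ y = Sum.inr b)

theorem low_le {θ : Setoid (Fin n)} {α : PM n} :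
    low θ ≤ α ↔ ∀ a b, θ a b → α (Sum.inr a) (Sum.inr b) := by
  constructor
  · intro h a b hab
    exact h (Relation.EqvGen.rel _ _ ⟨a, b, hab, rfl, rfl⟩)
  · intro h
    apply Setoid.eqvGen_le
    rintro x y ⟨a, b, hab, rfl, rfl⟩
    exact h a b hab

/-- `θ` on the upper row. -/
def up (θ : Setoid (Fin n)) : PM n := fl (low θ)

theorem up_le {θ : Setoid (Fin n)} {α : PM n} :
    up θ ≤ α ↔ ∀ a b, θ a b → α (Sum.inl a) (Sum.inl b) := by
  unfold up
  rw [fl_le, low_le]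
  rfl

def ext (θ : Setoid (Fin n)) : PM n := EE id id θ

theorem fl_EE {K : Type*} (c d : Fin n → K) (θ : Setoid K) : fl (EE c d θ) = EE d c θ := by
  ext u v
  rcases u with u | u <;> rcases v with v | v <;> rfl

theorem fl_ext (θ : Setoid (Fin n)) : fl (ext θ) = ext θ := fl_EE _ _ _

theorem mul_ext (α : PM n) (θ : Setoid (Fin n)) :
    pmul α (ext θ) = α ⊔ low θ ∧ Phi α (ext θ) = 0 := by
  have mb : ∀ y : Fin n, conn α (ext θ) (Sum.inr (Sum.inl y)) (Sum.inr (Sum.inr y)) := fun y =>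
    conn_r α (β := ext θ) (x := Sum.inl y) (y := Sum.inr y) (θ.refl' y)
  have hv : ∀ v : V n, conn α (ext θ) (topMid v) (topBot v) := by
    rintro (v | v)
    · exact conn_refl _ _ _
    · exact mb v
  constructor
  · ext u v
    constructor
    · intro h
      let f : W n → V n := Sum.elim Sum.inl (Sum.elim Sum.inr Sum.inr)
      have := conn_le (Setoid.comap f (α ⊔ low θ)) ?_ ?_ h
      · rcases u with u | u <;> rcases v with v | v <;> exact this
      · intro x y h
        have : (α ⊔ low θ) x y := (le_sup_left : α ≤ α ⊔ low θ) h
        rcases x with u | u <;> rcases y with v | v <;> exact this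
      · intro x y h
        have h' := low_le.1 (le_sup_right : low θ ≤ α ⊔ low θ)
        rcases x with u | u <;> rcases y with v | v <;> exact h' _ _ h
    · have : α ⊔ low θ ≤ pmul α (ext θ) := by
        refine sup_le ?_ ?_
        · intro x y h
          exact conn_trans (conn_symm (hv x)) (conn_trans (conn_l _ h) (hv y))
        · rw [low_le]
          intro a b h
          exact conn_r α (β := ext θ) (x := Sum.inr a) (y := Sum.inr b) h
      intro h
      exact this h
  · exact Phi_zero fun m => ⟨Sum.inr m, mb m⟩

theorem ext_mul (α : PM n) (θ : Setoid (Fin n)) :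
    pmul (ext θ) α = α ⊔ up θ ∧ Phi (ext θ) α = 0 := by
  have h1 := mul_ext (fl α) θ
  constructor
  · have h2 := pmul_fl (ext θ) α
    rw [fl_ext, h1.1] at h2
    rw [← fl_fl (pmul (ext θ) α), ← h2, fl_sup, fl_fl]
    rfl
  · rw [← Phi_fl, fl_ext, h1.2]

theorem low_bot (α : PM n) : low ⊥ ≤ α := by
  rw [low_le]
  rintro a b rfl
  exact α.refl' _

theorem up_bot (α : PM n) : up ⊥ ≤ α := by
  rw [up_le]
  rintro a b rfl
  exact α.refl' _

theorem rnk_ge {ρ : PM n} {p : ℕ} (a b : Fin p → Fin n)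
    (h1 : ∀ k, ρ (Sum.inl (a k)) (Sum.inr (b k)))
    (h2 : ∀ k l, ρ (Sum.inl (a k)) (Sum.inl (a l)) → k = l) : p ≤ rnk ρ := by
  unfold rnk
  let f : Fin p → {c : Quotient ρ // (∃ i : Fin n, Quotient.mk ρ (Sum.inl i) = c) ∧
      ∃ i : Fin n, Quotient.mk ρ (Sum.inr i) = c} := fun k =>
    ⟨Quotient.mk ρ (Sum.inl (a k)), ⟨a k, rfl⟩, ⟨b k, (Quotient.sound (h1 k)).symm⟩⟩
  have hf : Function.Injective f := by
    intro k l h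
    exact h2 k l (Quotient.exact (congrArg Subtype.val h))
  have := Nat.card_le_card_of_injective f hf
  simpa using this

theorem rnk_reps (ρ : PM n) : ∃ a b : Fin (rnk ρ) → Fin n,
    (∀ k, ρ (Sum.inl (a k)) (Sum.inr (b k))) ∧
    (∀ k l, ρ (Sum.inl (a k)) (Sum.inl (a l)) → k = l) ∧
    (∀ x y, ρ (Sum.inl x) (Sum.inr y) → ∃ k, ρ (Sum.inl x) (Sum.inl (a k))) := by
  let T := {c : Quotient ρ // (∃ i : Fin n, Quotient.mk ρ (Sum.inl i) = c) ∧
      ∃ i : Fin n, Quotient.mk ρ (Sum.inr i) = c}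
  let e : T ≃ Fin (rnk ρ) := Finite.equivFin T
  choose a ha using fun k => (e.symm k).2.1
  choose b hb using fun k => (e.symm k).2.2
  refine ⟨a, b, ?_, ?_, ?_⟩
  · intro k
    exact Quotient.exact ((ha k).trans (hb k).symm)
  · intro k l h
    have : (e.symm k).1 = (e.symm l).1 := by
      rw [← ha k, ← ha l]; exact Quotient.sound h
    exact e.symm.injective (Subtype.ext this)
  · intro x y h
    refine ⟨e ⟨Quotient.mk ρ (Sum.inl x), ⟨x, rfl⟩, ⟨y, (Quotient.sound h).symm⟩⟩, ?_⟩
    apply Quotient.exact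
    rw [ha, Equiv.symm_apply_apply]

theorem J_core (β ρ : PM n) (m : V n → Quotient ρ)
    (ha : ∀ x y, β x y → m x = m y)
    (hb : ∀ y, (∃ x, Quotient.mk ρ (Sum.inl x) = m (Sum.inl y)) ∨
      ∃ a b, m (Sum.inl a) = m (Sum.inl y) ∧ β (Sum.inl a) (Sum.inr b))
    (hc : ∀ y, ∃ z, Quotient.mk ρ (Sum.inr z) = m (Sum.inr y))
    (hd : ∀ x z, ρ (Sum.inl x) (Sum.inr z) →
      ∃ a b, m (Sum.inl a) = Quotient.mk ρ (Sum.inl x) ∧ β (Sum.inl a) (Sum.inr b)) :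
    ∃ γ δ : PM n, Phi γ β = 0 ∧ Phi (pmul γ β) δ = 0 ∧ pmul (pmul γ β) δ = ρ := by
  let u : Fin n → Quotient ρ := fun x => Quotient.mk ρ (Sum.inl x)
  let w : Fin n → Quotient ρ := fun x => Quotient.mk ρ (Sum.inr x)
  let γ : PM n := EE u (fun y => m (Sum.inl y)) ⊥
  let δ : PM n := EE (fun y => m (Sum.inr y)) w ⊥
  -- labels in the first product
  have lab1 : ∀ {x y}, conn γ β x y →
      (Sum.elim u (Sum.elim (fun y => m (Sum.inl y)) (fun y => m (Sum.inr y))) : W n → _) x =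
      (Sum.elim u (Sum.elim (fun y => m (Sum.inl y)) (fun y => m (Sum.inr y))) : W n → _) y := by
    intro x y h
    refine conn_label _ ?_ ?_ h
    · rintro (x | x) (y | y) h <;> exact h
    · rintro (x | x) (y | y) h <;> exact ha _ _ h
  have lab2 : ∀ {x y}, conn (pmul γ β) δ x y →
      (Sum.elim u (Sum.elim (fun y => m (Sum.inr y)) w) : W n → _) x =
      (Sum.elim u (Sum.elim (fun y => m (Sum.inr y)) w) : W n → _) y := by
    intro x y h
    refine conn_label _ ?_ ?_ h
    · rintro (x | x) (y | y) h <;> exact lab1 h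
    · rintro (x | x) (y | y) h <;> exact h
  have tm1 : ∀ x y, u x = m (Sum.inl y) → conn γ β (Sum.inl x) (Sum.inr (Sum.inl y)) :=
    fun x y h => conn_l (α := γ) β (x := Sum.inl x) (y := Sum.inr y) h
  have tt1 : ∀ x y, u x = u y → conn γ β (Sum.inl x) (Sum.inl y) :=
    fun x y h => conn_l (α := γ) β (x := Sum.inl x) (y := Sum.inl y) h
  have mm1 : ∀ x y, m (Sum.inl x) = m (Sum.inl y) →
      conn γ β (Sum.inr (Sum.inl x)) (Sum.inr (Sum.inl y)) :=
    fun x y h => conn_l (α := γ) β (x := Sum.inr x) (y := Sum.inr y) h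
  have mb2 : ∀ x y, m (Sum.inr x) = w y →
      conn (pmul γ β) δ (Sum.inr (Sum.inl x)) (Sum.inr (Sum.inr y)) :=
    fun x y h => conn_r (pmul γ β) (β := δ) (x := Sum.inl x) (y := Sum.inr y) h
  have bb2 : ∀ x y, w x = w y →
      conn (pmul γ β) δ (Sum.inr (Sum.inr x)) (Sum.inr (Sum.inr y)) :=
    fun x y h => conn_r (pmul γ β) (β := δ) (x := Sum.inr x) (y := Sum.inr y) h
  have tb2 : ∀ x z, u x = w z →
      conn (pmul γ β) δ (Sum.inl x) (Sum.inr (Sum.inr z)) := by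
    intro x z h
    obtain ⟨a, b, h1, h2⟩ := hd x z (Quotient.exact h)
    have h3 : conn γ β (Sum.inl x) (Sum.inr (Sum.inr b)) :=
      conn_trans (tm1 x a h1.symm) (conn_r γ (β := β) (x := Sum.inl a) (y := Sum.inr b) h2)
    have h4 : conn (pmul γ β) δ (Sum.inl x) (Sum.inr (Sum.inl b)) :=
      conn_l (α := pmul γ β) δ (x := Sum.inl x) (y := Sum.inr b) h3
    refine conn_trans h4 (mb2 b z ?_)
    rw [← ha _ _ h2, h1]; exact h
  refine ⟨γ, δ, ?_, ?_, ?_⟩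
  · apply Phi_zero
    intro y
    rcases hb y with ⟨x, hx⟩ | ⟨a, b, h1, h2⟩
    · exact ⟨Sum.inl x, conn_symm (tm1 x y hx)⟩
    · exact ⟨Sum.inr b, conn_trans (mm1 y a h1.symm)
        (conn_r γ (β := β) (x := Sum.inl a) (y := Sum.inr b) h2)⟩
  · apply Phi_zero
    intro y
    obtain ⟨z, hz⟩ := hc y
    exact ⟨Sum.inr z, mb2 y z hz.symm⟩
  · ext x y
    constructor
    · intro h
      have h' := lab2 h
      rcases x with x | x <;> rcases y with y | y <;> exact Quotient.exact h'
    · intro h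
      have h' : Quotient.mk ρ x = Quotient.mk ρ y := Quotient.sound h
      rcases x with x | x <;> rcases y with y | y
      · exact conn_l (α := pmul γ β) δ (x := Sum.inl x) (y := Sum.inl y) (tt1 x y h')
      · exact tb2 x y h'
      · exact conn_symm (tb2 y x h'.symm)
      · exact bb2 x y h'

open Classical in
theorem J_lemma (hn : 1 ≤ n) (β ρ : PM n) (h : rnk ρ ≤ rnk β) :
    ∃ γ δ : PM n, Phi γ β = 0 ∧ Phi (pmul γ β) δ = 0 ∧ pmul (pmul γ β) δ = ρ := by
  obtain ⟨a, b, h1, h2, h3⟩ := rnk_reps ρ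
  obtain ⟨a', b', h1', h2', h3'⟩ := rnk_reps β
  let z0 : Fin n := ⟨0, hn⟩
  rcases Nat.eq_zero_or_pos (rnk ρ) with h0 | h0
  · have hρ : ∀ x y, ¬ ρ (Sum.inl x) (Sum.inr y) := by
      intro x y hxy
      obtain ⟨k, _⟩ := h3 x y hxy
      exact absurd k.2 (by omega)
    rcases Nat.eq_zero_or_pos (rnk β) with h0' | h0'
    · have hβ : ∀ x y, ¬ β (Sum.inl x) (Sum.inr y) := by
        intro x y hxy
        obtain ⟨k, _⟩ := h3' x y hxy
        exact absurd k.2 (by omega)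
      refine J_core β ρ (Sum.elim (fun _ => Quotient.mk ρ (Sum.inl z0))
        (fun _ => Quotient.mk ρ (Sum.inr z0))) ?_ ?_ ?_ ?_
      · rintro (x | x) (y | y) hxy
        · rfl
        · exact absurd hxy (hβ _ _)
        · exact absurd (β.symm' hxy) (hβ _ _)
        · rfl
      · exact fun y => Or.inl ⟨z0, rfl⟩
      · exact fun y => ⟨z0, rfl⟩
      · exact fun x z hxz => absurd hxz (hρ _ _)
    · refine J_core β ρ (fun _ => Quotient.mk ρ (Sum.inr z0)) ?_ ?_ ?_ ?_
      · intros; rfl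
      · exact fun y => Or.inr ⟨a' ⟨0, h0'⟩, b' ⟨0, h0'⟩, rfl, h1' _⟩
      · exact fun y => ⟨z0, rfl⟩
      · exact fun x z hxz => absurd hxz (hρ _ _)
  · let tr : Fin (rnk β) → Fin (rnk ρ) := fun k => if h : k.1 < rnk ρ then ⟨k.1, h⟩ else ⟨0, h0⟩
    let g : Quotient β → Fin (rnk ρ) := fun z =>
      if h : ∃ k, z = Quotient.mk β (Sum.inl (a' k)) then tr h.choose else ⟨0, h0⟩
    have hg : ∀ k, g (Quotient.mk β (Sum.inl (a' k))) = tr k := by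
      intro k
      have hk : ∃ l, Quotient.mk β (Sum.inl (a' k)) = Quotient.mk β (Sum.inl (a' l)) := ⟨k, rfl⟩
      have : hk.choose = k := (h2' _ _ (Quotient.exact hk.choose_spec)).symm
      simp only [g]
      rw [dif_pos hk, this]
    refine J_core β ρ (fun v => Quotient.mk ρ (Sum.inl (a (g (Quotient.mk β v))))) ?_ ?_ ?_ ?_
    · intro x y hxy
      have : Quotient.mk β x = Quotient.mk β y := Quotient.sound hxy
      simp only [this]
    · exact fun y => Or.inl ⟨_, rfl⟩
    · exact fun y => ⟨_, (Quotient.sound (h1 _)).symm⟩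
    · intro x z hxz
      obtain ⟨k, hk⟩ := h3 x z hxz
      refine ⟨a' (Fin.castLE h k), b' (Fin.castLE h k), ?_, h1' _⟩
      have : tr (Fin.castLE h k) = k := by
        simp [tr]
      simp only [hg, this]
      exact Quotient.sound (ρ.symm' hk)

open Classical in
theorem greenR_sub {α β : PM n}
    (hker : ∀ x y, α (Sum.inl x) (Sum.inl y) ↔ β (Sum.inl x) (Sum.inl y))
    (hdom : ∀ x, (∃ y, α (Sum.inl x) (Sum.inr y)) ↔ ∃ y, β (Sum.inl x) (Sum.inr y)) :
    Set.range (pmul α) ⊆ Set.range (pmul β) := by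
  rintro _ ⟨δ, rfl⟩
  rcases Nat.eq_zero_or_pos n with rfl | hn
  · refine ⟨δ, ?_⟩
    ext x y
    rcases x with x | x <;> exact x.elim0
  let z0 : Fin n := ⟨0, hn⟩
  -- a choice of upper representative for lower points
  let g : Fin n → W n := fun p =>
    if h : ∃ a, β (Sum.inl a) (Sum.inr p) then Sum.inl h.choose else Sum.inl z0
  have hg : ∀ a p, β (Sum.inl a) (Sum.inr p) → ∃ a', g p = Sum.inl a' ∧ β (Sum.inl a) (Sum.inl a')
      := by
    intro a p h
    have hp : ∃ a, β (Sum.inl a) (Sum.inr p) := ⟨a, h⟩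
    refine ⟨hp.choose, ?_, β.trans' h (β.symm' hp.choose_spec)⟩
    simp only [g]
    rw [dif_pos hp]
  let G : V n → W n := Sum.elim g (fun y => Sum.inr (Sum.inr y))
  let δ' : PM n := Setoid.comap G (connSetoid α δ)
  have hαc : ∀ x y, β (Sum.inl x) (Sum.inl y) → conn α δ (Sum.inl x) (Sum.inl y) := fun x y h =>
    conn_l (α := α) δ (x := Sum.inl x) (y := Sum.inl y) ((hker x y).2 h)
  have htm : ∀ x y, β (Sum.inl x) (Sum.inr y) → conn α δ (Sum.inl x) (g y) := by
    intro x y h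
    obtain ⟨a', h1, h2⟩ := hg x y h
    rw [h1]
    exact hαc _ _ h2
  refine ⟨δ', ?_⟩
  ext u v
  constructor
  · intro h
    let f : W n → W n := Sum.elim Sum.inl (Sum.elim g (fun y => Sum.inr (Sum.inr y)))
    have := conn_le (Setoid.comap f (connSetoid α δ)) ?_ ?_ h
    · rcases u with u | u <;> rcases v with v | v <;> exact this
    · rintro (x | x) (y | y) h
      · exact hαc x y h
      · exact htm x y h
      · exact conn_symm (htm y x (β.symm' h))
      · change conn α δ (g x) (g y)
        by_cases hx : ∃ a, β (Sum.inl a) (Sum.inr x)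
        · obtain ⟨a, ha⟩ := hx
          exact conn_trans (conn_symm (htm a x ha)) (htm a y (β.trans' ha h))
        · have hy : ¬ ∃ a, β (Sum.inl a) (Sum.inr y) := by
            rintro ⟨a, ha⟩
            exact hx ⟨a, β.trans' ha (β.symm' h)⟩
          have : g x = g y := by
            simp only [g]
            rw [dif_neg hx, dif_neg hy]
          rw [this]
          exact conn_refl _ _ _
    · rintro (x | x) (y | y) h <;> exact h
  · intro h
    -- upper points outside the domain
    have iso : ∀ x v, (¬ ∃ y, α (Sum.inl x) (Sum.inr y)) → conn α δ (Sum.inl x) (topBot v) →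
        conn β δ' (Sum.inl x) (topBot v) := by
      intro x v hx h
      let P : W n → Prop := Sum.elim (fun y => α (Sum.inl x) (Sum.inl y)) (fun _ => False)
      have hP := conn_label P ?_ ?_ h
      · have hv : P (topBot v) := by
          rw [← hP]; exact α.refl' _
        rcases v with v | v
        · exact conn_l (α := β) δ' (x := Sum.inl x) (y := Sum.inl v) ((hker x v).1 hv)
        · exact hv.elim
      · rintro (y | y) (z | z) h
        · exact propext ⟨fun h' => α.trans' h' h, fun h' => α.trans' h' (α.symm' h)⟩
        · exact propext ⟨fun h' => hx ⟨z, α.trans' h' h⟩, fun h' => h'.elim⟩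
        · exact propext ⟨fun h' => h'.elim, fun h' => hx ⟨y, α.trans' h' (α.symm' h)⟩⟩
        · rfl
      · rintro (y | y) (z | z) h <;> rfl
    -- every other point is linked to a vertex of δ'
    have lnk : ∀ v : V n, (∃ x, v = Sum.inl x ∧ ¬ ∃ y, α (Sum.inl x) (Sum.inr y)) ∨
        ∃ z : V n, conn β δ' (topBot v) (midBot z) ∧ conn α δ (topBot v) (G z) := by
      rintro (x | x)
      · by_cases hx : ∃ y, α (Sum.inl x) (Sum.inr y)
        · obtain ⟨y, hy⟩ := (hdom x).1 hx
          exact Or.inr ⟨Sum.inl y, conn_l (α := β) δ' (x := Sum.inl x) (y := Sum.inr y) hy,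
            htm x y hy⟩
        · exact Or.inl ⟨x, rfl, hx⟩
      · exact Or.inr ⟨Sum.inr x, conn_refl _ _ _, conn_refl _ _ _⟩
    rcases lnk u with ⟨x, rfl, hx⟩ | ⟨z, hz1, hz2⟩
    · exact iso x v hx h
    rcases lnk v with ⟨x, rfl, hx⟩ | ⟨z', hz1', hz2'⟩
    · exact conn_symm (iso x u hx (conn_symm h))
    have : δ' z z' := conn_trans (conn_symm hz2) (conn_trans h hz2')
    exact conn_trans hz1 (conn_trans (conn_r β this) (conn_symm hz1'))

theorem greenR_of {α β : PM n}
    (hker : ∀ x y, α (Sum.inl x) (Sum.inl y) ↔ β (Sum.inl x) (Sum.inl y))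
    (hdom : ∀ x, (∃ y, α (Sum.inl x) (Sum.inr y)) ↔ ∃ y, β (Sum.inl x) (Sum.inr y)) :
    greenR pmul α β :=
  Set.Subset.antisymm (greenR_sub hker hdom)
    (greenR_sub (fun x y => (hker x y).symm) (fun x => (hdom x).symm))

theorem greenL_of_fl {α β : PM n} (h : greenR pmul (fl α) (fl β)) : greenL pmul α β := by
  have key : ∀ α β : PM n, Set.range (pmul (fl α)) ⊆ Set.range (pmul (fl β)) →
      Set.range (fun a => pmul a α) ⊆ Set.range (fun a => pmul a β) := by
    rintro α β h _ ⟨γ, rfl⟩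
    obtain ⟨δ, hδ⟩ := h ⟨fl γ, rfl⟩
    refine ⟨fl δ, ?_⟩
    change pmul (fl δ) β = pmul γ α
    rw [pmul_fl, ← fl_fl δ, pmul_fl] at hδ
    have := congrArg fl hδ
    rwa [fl_fl, fl_fl] at this
  exact Set.Subset.antisymm (key _ _ h.le) (key _ _ h.ge)


/-- The congruence hypothesis, unpacked. -/
theorem cg_left {σ : (ℕ × PM n) → (ℕ × PM n) → Prop} (hσ : IsCongruence (tmul (n := n)) σ)
    {i j : ℕ} {α β : PM n} (h : σ (i, α) (j, β)) (γ : PM n) (h1 : Phi γ α = 0)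
    (h2 : Phi γ β = 0) : σ (i, pmul γ α) (j, pmul γ β) := by
  have := (hσ.2 _ _ (0, γ) h).1
  simpa [tmul, h1, h2] using this

theorem cg_right {σ : (ℕ × PM n) → (ℕ × PM n) → Prop} (hσ : IsCongruence (tmul (n := n)) σ)
    {i j : ℕ} {α β : PM n} (h : σ (i, α) (j, β)) (γ : PM n) (h1 : Phi α γ = 0)
    (h2 : Phi β γ = 0) : σ (i, pmul α γ) (j, pmul β γ) := by
  have := (hσ.2 _ _ (0, γ) h).2
  simpa [tmul, h1, h2] using this

theorem cg_up {σ : (ℕ × PM n) → (ℕ × PM n) → Prop} (hσ : IsCongruence (tmul (n := n)) σ)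
    {i j : ℕ} {α β : PM n} (h : σ (i, α) (j, β)) (θ : Setoid (Fin n)) :
    σ (i, α ⊔ up θ) (j, β ⊔ up θ) := by
  have := cg_left hσ h (ext θ) (ext_mul α θ).2 (ext_mul β θ).2
  rwa [(ext_mul α θ).1, (ext_mul β θ).1] at this

theorem cg_low {σ : (ℕ × PM n) → (ℕ × PM n) → Prop} (hσ : IsCongruence (tmul (n := n)) σ)
    {i j : ℕ} {α β : PM n} (h : σ (i, α) (j, β)) (θ : Setoid (Fin n)) :
    σ (i, α ⊔ low θ) (j, β ⊔ low θ) := by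
  have := cg_right hσ h (ext θ) (mul_ext α θ).2 (mul_ext β θ).2
  rwa [(mul_ext α θ).1, (mul_ext β θ).1] at this

theorem tw_eq (k i : ℕ) (α : PM n) : tmul (k, ext ⊥) (i, α) = (k + i, α) := by
  have h1 := ext_mul α ⊥
  rw [sup_eq_left.2 (up_bot α)] at h1
  simp [tmul, h1.1, h1.2]

theorem cg_tw {σ : (ℕ × PM n) → (ℕ × PM n) → Prop} (hσ : IsCongruence (tmul (n := n)) σ)
    {i j : ℕ} {α β : PM n} (h : σ (i, α) (j, β)) (k : ℕ) : σ (k + i, α) (k + j, β) := by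
  have := (hσ.2 _ _ (k, ext ⊥) h).1
  rwa [tw_eq, tw_eq] at this

theorem cg_flip {σ : (ℕ × PM n) → (ℕ × PM n) → Prop} (hσ : IsCongruence (tmul (n := n)) σ) :
    IsCongruence (tmul (n := n)) (fun x y => σ (x.1, fl x.2) (y.1, fl y.2)) := by
  have key : ∀ a x : ℕ × PM n, ((tmul a x).1, fl (tmul a x).2) =
      tmul (x.1, fl x.2) (a.1, fl a.2) := by
    intro a x
    simp only [tmul, pmul_fl, Phi_fl]
    rw [add_comm a.1]
  refine ⟨⟨fun x => hσ.1.refl _, fun h => hσ.1.symm h, fun h h' => hσ.1.trans h h'⟩, ?_⟩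
  intro x y a h
  simp only [key]
  exact ⟨(hσ.2 _ _ _ h).2, (hσ.2 _ _ _ h).1⟩

/-- Equivalence generated by one pair. -/
def gen {K : Type*} (k l : K) : Setoid K := Relation.EqvGen.setoid (fun x y => x = k ∧ y = l)

theorem gen_le {K : Type*} {k l : K} {S : Setoid K} : gen k l ≤ S ↔ S k l := by
  constructor
  · intro h
    exact h (Relation.EqvGen.rel _ _ ⟨rfl, rfl⟩)
  · intro h
    apply Setoid.eqvGen_le
    rintro x y ⟨rfl, rfl⟩
    exact h

theorem gen_rel {K : Type*} (k l : K) : gen k l k l := gen_le.1 le_rfl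

theorem low_gen_le {a b : Fin n} {α : PM n} : low (gen a b) ≤ α ↔ α (Sum.inr a) (Sum.inr b) := by
  rw [low_le]
  constructor
  · intro h; exact h _ _ (gen_rel a b)
  · intro h x y hxy
    exact (gen_le (S := Setoid.comap Sum.inr α)).2 h hxy

theorem up_gen_le {a b : Fin n} {α : PM n} : up (gen a b) ≤ α ↔ α (Sum.inl a) (Sum.inl b) := by
  unfold up
  rw [fl_le, low_gen_le]
  rfl

def Cond (α β : PM n) : Prop :=
  (∃ b b', β (Sum.inr b) (Sum.inr b') ∧ ¬ α (Sum.inr b) (Sum.inr b')) ∨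
  ((∀ b b', β (Sum.inr b) (Sum.inr b') → α (Sum.inr b) (Sum.inr b')) ∧
    ∃ p, (∃ a, α (Sum.inl a) (Sum.inr p)) ∧ ¬ ∃ a, β (Sum.inl a) (Sum.inr p))

open Classical in
theorem chi_mul (β : PM n) (p b : Fin n) (hp : ¬ ∃ a, β (Sum.inl a) (Sum.inr p))
    (hb : ¬ β (Sum.inr b) (Sum.inr p)) :
    ∃ χ : PM n, pmul β χ = β ∧ (∀ γ, Phi γ χ = 0) ∧ χ (Sum.inl p) (Sum.inl b) := by
  let u : Fin n → Option (Fin n) := fun x => if β (Sum.inr x) (Sum.inr p) then some b else some x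
  let w : Fin n → Option (Fin n) := fun x => if β (Sum.inr x) (Sum.inr p) then none else some x
  have u1 : ∀ x, β (Sum.inr x) (Sum.inr p) → u x = some b := fun x h => if_pos h
  have u2 : ∀ x, ¬ β (Sum.inr x) (Sum.inr p) → u x = some x := fun x h => if_neg h
  have w1 : ∀ x, β (Sum.inr x) (Sum.inr p) → w x = none := fun x h => if_pos h
  have w2 : ∀ x, ¬ β (Sum.inr x) (Sum.inr p) → w x = some x := fun x h => if_neg h
  let χ : PM n := EE u w ⊥
  have e1 : ∀ γ x y, u x = w y → conn γ χ (Sum.inr (Sum.inl x)) (Sum.inr (Sum.inr y)) :=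
    fun γ x y h => conn_r γ (β := χ) (x := Sum.inl x) (y := Sum.inr y) h
  refine ⟨χ, ?_, ?_, ?_⟩
  · ext x y
    constructor
    · intro h
      let g : Option (Fin n) → Quotient β := fun o => o.elim (Quotient.mk β (Sum.inr p))
        (fun x => Quotient.mk β (Sum.inr x))
      let f : W n → Quotient β := Sum.elim (fun x => Quotient.mk β (Sum.inl x))
        (Sum.elim (fun x => g (u x)) (fun x => g (w x)))
      have hw : ∀ x, g (w x) = Quotient.mk β (Sum.inr x) := by
        intro x
        by_cases hx : β (Sum.inr x) (Sum.inr p)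
        · rw [w1 x hx]; exact (Quotient.sound hx).symm
        · rw [w2 x hx]; rfl
      have key : f (topBot x) = f (topBot y) := by
        refine conn_label f ?_ ?_ h
        · have tm : ∀ x y, β (Sum.inl x) (Sum.inr y) → f (Sum.inl x) = f (Sum.inr (Sum.inl y)) := by
            intro x y h
            have : ¬ β (Sum.inr y) (Sum.inr p) := fun h' => hp ⟨x, β.trans' h h'⟩
            change _ = g (u y)
            rw [u2 y this]
            exact Quotient.sound h
          rintro (x | x) (y | y) h
          · exact Quotient.sound h
          · exact tm x y h
          · exact (tm y x (β.symm' h)).symm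
          · change g (u x) = g (u y)
            by_cases hx : β (Sum.inr x) (Sum.inr p)
            · rw [u1 x hx, u1 y (β.trans' (β.symm' h) hx)]
            · rw [u2 x hx, u2 y (fun hy => hx (β.trans' h hy))]
              exact Quotient.sound h
        · rintro (x | x) (y | y) h <;> exact congrArg g h
      rcases x with x | x <;> rcases y with y | y
      · exact Quotient.exact key
      · exact Quotient.exact (key.trans (hw y))
      · exact Quotient.exact ((hw x).symm.trans key)
      · exact Quotient.exact ((hw x).symm.trans (key.trans (hw y)))
    · have tb : ∀ x y, β (Sum.inl x) (Sum.inr y) → conn β χ (Sum.inl x) (Sum.inr (Sum.inr y)) := by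
        intro x y h
        have hy : ¬ β (Sum.inr y) (Sum.inr p) := fun h' => hp ⟨x, β.trans' h h'⟩
        exact conn_trans (conn_l (α := β) χ (x := Sum.inl x) (y := Sum.inr y) h)
          (e1 β y y ((u2 y hy).trans (w2 y hy).symm))
      intro h
      rcases x with x | x <;> rcases y with y | y
      · exact conn_l (α := β) χ (x := Sum.inl x) (y := Sum.inl y) h
      · exact tb x y h
      · exact conn_symm (tb y x (β.symm' h))
      · by_cases hx : β (Sum.inr x) (Sum.inr p)
        · refine conn_r β (β := χ) (x := Sum.inr x) (y := Sum.inr y) ?_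
          change w x = w y
          rw [w1 x hx, w1 y (β.trans' (β.symm' h) hx)]
        · have hy : ¬ β (Sum.inr y) (Sum.inr p) := fun hy => hx (β.trans' h hy)
          exact conn_trans (conn_symm (e1 β x x ((u2 x hx).trans (w2 x hx).symm)))
            (conn_trans (conn_l (α := β) χ (x := Sum.inr x) (y := Sum.inr y) h)
              (e1 β y y ((u2 y hy).trans (w2 y hy).symm)))
  · intro γ
    apply Phi_zero
    intro m
    by_cases hm : β (Sum.inr m) (Sum.inr p)
    · exact ⟨Sum.inr b, e1 γ m b ((u1 m hm).trans (w2 b hb).symm)⟩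
    · exact ⟨Sum.inr m, e1 γ m m ((u2 m hm).trans (w2 m hm).symm)⟩
  · change u p = u b
    rw [u1 p (β.refl' _), u2 b hb]

theorem C1 {σ : (ℕ × PM n) → (ℕ × PM n) → Prop} (hσ : IsCongruence (tmul (n := n)) σ)
    {i j : ℕ} {α β : PM n} (h : σ (i, α) (j, β)) (h2 : 2 ≤ rnk α) (hc : Cond α β) :
    ∃ b b', ¬ α (Sum.inr b) (Sum.inr b') ∧ σ (i, α) (i, α ⊔ low (gen b b')) := by
  rcases hc with ⟨b, b', hb, hα⟩ | ⟨hk, p, ⟨ap, hap⟩, hp⟩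
  · refine ⟨b, b', hα, ?_⟩
    have h1 := cg_low hσ h (gen b b')
    rw [sup_eq_left.2 (low_gen_le.2 hb)] at h1
    exact hσ.1.trans h (hσ.1.symm h1)
  · obtain ⟨a, b, r1, r2, r3⟩ := rnk_reps α
    obtain ⟨k, hk0⟩ := r3 ap p hap
    have : Nontrivial (Fin (rnk α)) := Fin.nontrivial_iff_two_le.2 h2
    obtain ⟨l, hl⟩ := exists_ne k
    have hbp : ¬ α (Sum.inr (b l)) (Sum.inr p) := by
      intro h
      apply hl
      apply r2
      exact α.trans' (r1 l) (α.trans' h (α.trans' (α.symm' hap) hk0))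
    obtain ⟨χ, x1, x2, x3⟩ := chi_mul β p (b l) hp (fun h => hbp (hk _ _ h))
    refine ⟨p, b l, fun h => hbp (α.symm' h), ?_⟩
    have h1 := cg_right hσ h χ (x2 _) (x2 _)
    rw [x1] at h1
    have h3 : σ (i, α) (i, pmul α χ) := hσ.1.trans h (hσ.1.symm h1)
    have h4 := cg_up hσ h3 (gen ap (a l))
    have e1 : pmul α χ ⊔ up (gen ap (a l)) = pmul α χ := by
      rw [sup_eq_left, up_gen_le]
      exact conn_trans (conn_l (α := α) χ (x := Sum.inl ap) (y := Sum.inr p) hap)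
        (conn_trans (conn_r α (β := χ) (x := Sum.inl p) (y := Sum.inl (b l)) x3)
          (conn_symm (conn_l (α := α) χ (x := Sum.inl (a l)) (y := Sum.inr (b l)) (r1 l))))
    have e2 : α ⊔ up (gen ap (a l)) = α ⊔ low (gen p (b l)) := by
      apply le_antisymm
      · refine sup_le le_sup_left ?_
        rw [up_gen_le]
        have m1 : α ≤ α ⊔ low (gen p (b l)) := le_sup_left
        have m2 := low_gen_le.1 (le_sup_right : low (gen p (b l)) ≤ α ⊔ low (gen p (b l)))
        exact Setoid.trans' _ (m1 hap) (Setoid.trans' _ m2 (Setoid.symm' _ (m1 (r1 l))))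
      · refine sup_le le_sup_left ?_
        rw [low_gen_le]
        have m1 : α ≤ α ⊔ up (gen ap (a l)) := le_sup_left
        have m2 := up_gen_le.1 (le_sup_right : up (gen ap (a l)) ≤ α ⊔ up (gen ap (a l)))
        exact Setoid.trans' _ (Setoid.symm' _ (m1 hap)) (Setoid.trans' _ m2 (m1 (r1 l)))
    rw [e1, e2] at h4
    exact hσ.1.trans h3 (hσ.1.symm h4)

open Classical in
theorem C2 (α : PM n) (h2 : 2 ≤ rnk α) (y y' : Fin n) (hy : ¬ α (Sum.inr y) (Sum.inr y')) :
    ∃ (g : V n → Fin (rnk α)) (a b : Fin (rnk α) → Fin n), (∀ u v, α u v → g u = g v) ∧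
      (∀ k, α (Sum.inl (a k)) (Sum.inr (b k))) ∧ (∀ k, g (Sum.inl (a k)) = k) ∧
      g (Sum.inr y) ≠ g (Sum.inr y') := by
  obtain ⟨a, b, r1, r2, r3⟩ := rnk_reps α
  have : Nontrivial (Fin (rnk α)) := Fin.nontrivial_iff_two_le.2 h2
  let P : V n → Prop := fun v => ∃ k, α v (Sum.inl (a k))
  let G : Fin (rnk α) → Fin (rnk α) → V n → Fin (rnk α) := fun s t v =>
    if h : P v then h.choose else if α v (Sum.inr y) then s else t
  have G1 : ∀ s t v k, α v (Sum.inl (a k)) → G s t v = k := by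
    intro s t v k hk
    have hP : P v := ⟨k, hk⟩
    simp only [G]
    rw [dif_pos hP]
    exact r2 _ _ (α.trans' (α.symm' hP.choose_spec) hk)
  have G2 : ∀ s t v, ¬ P v → α v (Sum.inr y) → G s t v = s := by
    intro s t v hv h
    simp only [G]
    rw [dif_neg hv, if_pos h]
  have G3 : ∀ s t v, ¬ P v → ¬ α v (Sum.inr y) → G s t v = t := by
    intro s t v hv h
    simp only [G]
    rw [dif_neg hv, if_neg h]
  have inv : ∀ s t u v, α u v → G s t u = G s t v := by
    intro s t u v h
    by_cases hu : P u
    · obtain ⟨k, hk⟩ := hu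
      rw [G1 s t u k hk, G1 s t v k (α.trans' (α.symm' h) hk)]
    · have hv : ¬ P v := fun ⟨k, hk⟩ => hu ⟨k, α.trans' h hk⟩
      by_cases hu' : α u (Sum.inr y)
      · rw [G2 s t u hu hu', G2 s t v hv (α.trans' (α.symm' h) hu')]
      · rw [G3 s t u hu hu', G3 s t v hv (fun h' => hu' (α.trans' h h'))]
  have key : ∃ s t, G s t (Sum.inr y) ≠ G s t (Sum.inr y') := by
    have hy' : ¬ α (Sum.inr y') (Sum.inr y) := fun h => hy (α.symm' h)
    obtain ⟨s0, t0, hst⟩ := exists_pair_ne (Fin (rnk α))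
    by_cases p1 : P (Sum.inr y) <;> by_cases p2 : P (Sum.inr y')
    · obtain ⟨k, hk⟩ := p1
      obtain ⟨l, hl⟩ := p2
      refine ⟨s0, s0, ?_⟩
      rw [G1 _ _ _ k hk, G1 _ _ _ l hl]
      rintro rfl
      exact hy (α.trans' hk (α.symm' hl))
    · obtain ⟨k, hk⟩ := p1
      obtain ⟨l, hl⟩ := exists_ne k
      refine ⟨l, l, ?_⟩
      rw [G1 _ _ _ k hk, G3 _ _ _ p2 hy']
      exact hl.symm
    · obtain ⟨k, hk⟩ := p2
      obtain ⟨l, hl⟩ := exists_ne k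
      refine ⟨l, l, ?_⟩
      rw [G1 _ _ _ k hk, G2 _ _ _ p1 (α.refl' _)]
      exact hl
    · refine ⟨s0, t0, ?_⟩
      rw [G3 _ _ _ p2 hy', G2 _ _ _ p1 (α.refl' _)]
      exact hst
  obtain ⟨s, t, hst⟩ := key
  exact ⟨G s t, a, b, inv s t, r1, fun k => G1 _ _ _ k (α.refl' _), hst⟩

theorem C3 {σ : (ℕ × PM n) → (ℕ × PM n) → Prop} (hσ : IsCongruence (tmul (n := n)) σ)
    {i : ℕ} {α : PM n} (h2 : 2 ≤ rnk α) (y y' : Fin n) (hy : ¬ α (Sum.inr y) (Sum.inr y'))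
    (h : σ (i, α) (i, α ⊔ low (gen y y'))) :
    ∃ (c d : Fin n → Fin (rnk α)) (a b : Fin (rnk α) → Fin n), (∀ k, c (a k) = k) ∧
      (∀ k, d (b k) = k) ∧ ∃ k l, k ≠ l ∧ σ (i, EE c d ⊥) (i, EE c d (gen k l)) := by
  obtain ⟨g, a, b, g1, g2, g3, g4⟩ := C2 α h2 y y' hy
  let c : Fin n → Fin (rnk α) := fun x => g (Sum.inl x)
  let d : Fin n → Fin (rnk α) := fun x => g (Sum.inr x)
  have hg : ∀ v, Sum.elim c d v = g v := by rintro (v | v) <;> rfl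
  have hd : ∀ k, d (b k) = k := fun k => (g1 _ _ (g2 k)).symm.trans (g3 k)
  refine ⟨c, d, a, b, g3, hd, d y, d y', g4, ?_⟩
  have e1 : α ⊔ up (Setoid.ker c) ⊔ low (Setoid.ker d) = EE c d ⊥ := by
    apply le_antisymm
    · refine sup_le (sup_le ?_ ?_) ?_
      · intro u v huv
        change Sum.elim c d u = Sum.elim c d v
        rw [hg, hg]; exact g1 _ _ huv
      · rw [up_le]; intro a b h; exact h
      · rw [low_le]; intro a b h; exact h
    · have m0 : α ≤ α ⊔ up (Setoid.ker c) ⊔ low (Setoid.ker d) :=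
        le_sup_left.trans le_sup_left
      have m1 := up_le.1 (le_sup_right.trans le_sup_left :
        up (Setoid.ker c) ≤ α ⊔ up (Setoid.ker c) ⊔ low (Setoid.ker d))
      have m2 := low_le.1 (le_sup_right :
        low (Setoid.ker d) ≤ α ⊔ up (Setoid.ker c) ⊔ low (Setoid.ker d))
      have key : ∀ v, (α ⊔ up (Setoid.ker c) ⊔ low (Setoid.ker d)) v (Sum.inl (a (Sum.elim c d v)))
          := by
        rintro (v | v)
        · exact m1 _ _ (g3 (c v)).symm
        · exact Setoid.trans' _ (m2 v (b (d v)) (hd (d v)).symm) (Setoid.symm' _ (m0 (g2 (d v))))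
      intro u v huv
      have huv' : Sum.elim c d u = Sum.elim c d v := huv
      have ku := key u
      rw [huv'] at ku
      exact Setoid.trans' _ ku (Setoid.symm' _ (key v))
  have e2 : EE c d ⊥ ⊔ low (gen y y') = EE c d (gen (d y) (d y')) := by
    apply le_antisymm
    · refine sup_le ?_ ?_
      · intro u v huv
        have huv' : Sum.elim c d u = Sum.elim c d v := huv
        change (gen (d y) (d y')) _ _
        rw [huv']
      · rw [low_gen_le]; exact gen_rel _ _
    · have m0 : EE c d ⊥ ≤ EE c d ⊥ ⊔ low (gen y y') := le_sup_left
      have m1 := low_gen_le.1 (le_sup_right : low (gen y y') ≤ EE c d ⊥ ⊔ low (gen y y'))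
      have key : ∀ v, (EE c d ⊥ ⊔ low (gen y y')) v (Sum.inl (a (Sum.elim c d v))) := by
        intro v
        apply m0
        change Sum.elim c d v = c (a _)
        exact (g3 _).symm
      have hS : gen (d y) (d y') ≤ Setoid.comap (fun k => Sum.inl (a k))
          (EE c d ⊥ ⊔ low (gen y y')) := by
        rw [gen_le]
        change (EE c d ⊥ ⊔ low (gen y y')) (Sum.inl (a (d y))) (Sum.inl (a (d y')))
        exact Setoid.trans' _ (Setoid.symm' _ (key (Sum.inr y))) (Setoid.trans' _ m1
          (key (Sum.inr y')))
      intro u v huv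
      exact Setoid.trans' _ (key u) (Setoid.trans' _ (hS huv) (Setoid.symm' _ (key v)))
  have h1 := cg_low hσ (cg_up hσ h (Setoid.ker c)) (Setoid.ker d)
  have e3 : α ⊔ low (gen y y') ⊔ up (Setoid.ker c) ⊔ low (Setoid.ker d) =
      α ⊔ up (Setoid.ker c) ⊔ low (Setoid.ker d) ⊔ low (gen y y') := by
    ac_rfl
  rwa [e3, e1, e2] at h1

theorem finSetoid (K : Type*) [Finite K] : Finite (Setoid K) :=
  Finite.of_injective (fun s : Setoid K => (fun x y => s x y : K → K → Prop)) (by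
    intro s t h
    ext x y
    exact iff_of_eq (congrFun (congrFun h x) y))

theorem EE_top {K : Type*} (c d : Fin n → K) : EE c d ⊤ = ⊤ := by
  ext u v
  exact ⟨fun _ => trivial, fun _ => trivial⟩

theorem C4 {σ : (ℕ × PM n) → (ℕ × PM n) → Prop} (hσ : IsCongruence (tmul (n := n)) σ)
    {i : ℕ} {K : Type*} [Finite K] (c d : Fin n → K) (hc : Function.Surjective c)
    (hd : Function.Surjective d) (k l : K) (hkl : k ≠ l)
    (h : σ (i, EE c d ⊥) (i, EE c d (gen k l))) : σ (i, EE c d ⊥) (i, ⊤) := by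
  classical
  have all : ∀ k' l', σ (i, EE c d ⊥) (i, EE c d (gen k' l')) := by
    intro k' l'
    by_cases hkl' : k' = l'
    · subst hkl'
      have : gen k' k' = ⊥ := by
        rw [eq_bot_iff, gen_le]
      rw [this]
      exact hσ.1.refl _
    obtain ⟨π, hπ1, hπ2⟩ : ∃ π : Equiv.Perm K, π k = k' ∧ π l = l' := by
      refine ⟨Equiv.swap (Equiv.swap k k' l) l' * Equiv.swap k k', ?_, ?_⟩
      · simp only [Equiv.Perm.coe_mul, Function.comp, Equiv.swap_apply_left]
        apply Equiv.swap_apply_of_ne_of_ne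
        · intro h
          have := congrArg (Equiv.swap k k') h
          simp at this
          exact hkl this
        · exact hkl'
      · simp
    have hs : ∀ f : Fin n → K, Function.Surjective f → Function.Surjective (π ∘ f) :=
      fun f hf => π.surjective.comp hf
    have tr : ∀ θ : Setoid K, EE (π ∘ c) (π ∘ d) θ = EE c d (Setoid.comap π θ) := by
      intro θ
      ext u v
      rcases u with u | u <;> rcases v with v | v <;> rfl
    have b1 : Setoid.comap π (⊥ : Setoid K) = ⊥ := by
      ext u v
      exact π.injective.eq_iff
    have b2 : Setoid.comap π (gen k' l') = gen k l := by
      apply le_antisymm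
      · have : gen k' l' ≤ Setoid.comap π.symm (gen k l) := by
          rw [gen_le]
          change gen k l (π.symm k') (π.symm l')
          rw [← hπ1, ← hπ2]
          simpa using gen_rel k l
        intro u v huv
        have := this huv
        change gen k l (π.symm (π u)) (π.symm (π v)) at this
        simpa using this
      · rw [gen_le]
        change gen k' l' (π k) (π l)
        rw [hπ1, hπ2]
        exact gen_rel _ _
    have L := fun θ => EE_mul c (π ∘ c) (π ∘ d) (hs c hc) (hs d hd) ⊥ θ
    have R := fun θ => EE_mul c (π ∘ d) d (hs d hd) hd θ ⊥
    have h0 : σ (i, EE (π ∘ c) (π ∘ d) ⊥) (i, EE (π ∘ c) (π ∘ d) (gen k' l')) := by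
      rw [tr, tr, b1, b2]; exact h
    have h1 := cg_left hσ h0 _ (L _).2 (L _).2
    rw [(L _).1, (L _).1, bot_sup_eq, bot_sup_eq] at h1
    have h2 := cg_right hσ h1 _ (R _).2 (R _).2
    rwa [(R _).1, (R _).1, sup_bot_eq, sup_bot_eq] at h2
  have := finSetoid K
  obtain ⟨θ, hθ, hmax⟩ := Set.Finite.exists_maximal (Set.toFinite {θ : Setoid K |
    σ (i, EE c d ⊥) (i, EE c d θ)}) ⟨⊥, hσ.1.refl _⟩
  have : θ = ⊤ := by
    rw [eq_top_iff]
    intro k' l' _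
    have J := fun θ => EE_mul c d d hd hd θ (gen k' l')
    have h1 := cg_right hσ hθ _ (J _).2 (J _).2
    rw [(J _).1, (J _).1, bot_sup_eq] at h1
    have h2 := hmax (hσ.1.trans (all k' l') h1) le_sup_left
    exact gen_le.1 (le_sup_right.trans h2)
  subst this
  have hθ' : σ (i, EE c d ⊥) (i, EE c d ⊤) := hθ
  rwa [EE_top] at hθ'

theorem C5 {σ : (ℕ × PM n) → (ℕ × PM n) → Prop} (hσ : IsCongruence (tmul (n := n)) σ)
    {i : ℕ} {q : ℕ} (h2 : 2 ≤ q) (c d : Fin n → Fin q) (hc : Function.Surjective c)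
    (hd : Function.Surjective d)
    (h : σ (i, EE c d ⊥) (i, ⊤)) :
    ∃ c' d' : Fin n → Bool, Function.Surjective c' ∧ Function.Surjective d' ∧
      σ (i, EE c' d' ⊥) (i, ⊤) := by
  let f : Fin q → Bool := fun k => decide (k.1 = 0)
  have hf : Function.Surjective f := by
    rintro (_ | _)
    · exact ⟨⟨1, by omega⟩, by simp [f]⟩
    · exact ⟨⟨0, by omega⟩, by simp [f]⟩
  refine ⟨f ∘ c, f ∘ d, hf.comp hc, hf.comp hd, ?_⟩
  rw [← EE_top c d] at h
  have J := fun θ => EE_mul c d d hd hd θ (Setoid.ker f)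
  have h1 := cg_right hσ h _ (J _).2 (J _).2
  rw [(J _).1, (J _).1, bot_sup_eq, top_sup_eq, EE_top] at h1
  have : EE c d (Setoid.ker f) = EE (f ∘ c) (f ∘ d) ⊥ := by
    ext u v
    rcases u with u | u <;> rcases v with v | v <;> rfl
  rwa [← this]

/-- Products of labelled partitions. -/
theorem EE_mul_bot {K : Type*} (u m w : Fin n → K)
    (h1 : ∀ x y, u x = w y → ∃ z, m z = u x)
    (h2 : ∀ z, (∃ x, u x = m z) ∨ ∃ y, w y = m z) :
    pmul (EE u m ⊥) (EE m w ⊥) = EE u w ⊥ ∧ Phi (EE u m ⊥) (EE m w ⊥) = 0 := by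
  have tm : ∀ x y, u x = m y →
      conn (EE u m ⊥) (EE m w ⊥) (Sum.inl x) (Sum.inr (Sum.inl y)) := fun x y h =>
    conn_l (α := EE u m ⊥) (EE m w ⊥) (x := Sum.inl x) (y := Sum.inr y) h
  have mb : ∀ x y, m x = w y →
      conn (EE u m ⊥) (EE m w ⊥) (Sum.inr (Sum.inl x)) (Sum.inr (Sum.inr y)) := fun x y h =>
    conn_r (EE u m ⊥) (β := EE m w ⊥) (x := Sum.inl x) (y := Sum.inr y) h
  have tb : ∀ x y, u x = w y →
      conn (EE u m ⊥) (EE m w ⊥) (Sum.inl x) (Sum.inr (Sum.inr y)) := by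
    intro x y h
    obtain ⟨z, hz⟩ := h1 x y h
    exact conn_trans (tm x z hz.symm) (mb z y (hz.trans h))
  constructor
  · ext x y
    constructor
    · intro h
      let f : W n → K := Sum.elim u (Sum.elim m w)
      have key : f (topBot x) = f (topBot y) := by
        refine conn_label f ?_ ?_ h
        · rintro (x | x) (y | y) h <;> exact h
        · rintro (x | x) (y | y) h <;> exact h
      rcases x with x | x <;> rcases y with y | y <;> exact key
    · intro h
      rcases x with x | x <;> rcases y with y | y
      · exact conn_l (α := EE u m ⊥) (EE m w ⊥) (x := Sum.inl x) (y := Sum.inl y) h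
      · exact tb x y h
      · exact conn_symm (tb y x (Eq.symm h))
      · exact conn_r (EE u m ⊥) (β := EE m w ⊥) (x := Sum.inr x) (y := Sum.inr y) h
  · apply Phi_zero
    intro z
    rcases h2 z with ⟨x, hx⟩ | ⟨y, hy⟩
    · exact ⟨Sum.inl x, conn_symm (tm x z hx)⟩
    · exact ⟨Sum.inr y, mb z y hy.symm⟩

/-- Partitions all of whose lower points are related. -/
def TT (τ : Setoid (Option (Fin n))) : PM n := EE some (fun _ => none) τ

theorem TT_of (hn : 1 ≤ n) (ρ : PM n) (h : ∀ y y', ρ (Sum.inr y) (Sum.inr y')) :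
    ρ = TT (Setoid.comap (fun o : Option (Fin n) =>
      o.elim (Sum.inr ⟨0, hn⟩) (fun x => Sum.inl x)) ρ) := by
  ext x y
  rcases x with x | x <;> rcases y with y | y
  · exact Iff.rfl
  · exact ⟨fun h' => ρ.trans' h' (h _ _), fun h' => ρ.trans' h' (h _ _)⟩
  · exact ⟨fun h' => ρ.trans' (h _ _) h', fun h' => ρ.trans' (h _ _) h'⟩
  · exact ⟨fun _ => ρ.refl' _, fun _ => h _ _⟩

theorem mul_top (hn : 1 ≤ n) (s : PM n) :
    Phi s ⊤ = 0 ∧ ∀ y y', pmul s ⊤ (Sum.inr y) (Sum.inr y') := by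
  constructor
  · apply Phi_zero
    intro m
    exact ⟨Sum.inr ⟨0, hn⟩, conn_r s (β := ⊤) (x := Sum.inl m) (y := Sum.inr ⟨0, hn⟩) trivial⟩
  · intro y y'
    exact conn_r s (β := ⊤) (x := Sum.inr y) (y := Sum.inr y') trivial

theorem TT_top {σ : (ℕ × PM n) → (ℕ × PM n) → Prop} (hσ : IsCongruence (tmul (n := n)) σ)
    (hn : 1 ≤ n) {i : ℕ} (c d : Fin n → Bool) (hc : Function.Surjective c)
    (hd : Function.Surjective d) (h : σ (i, EE c d ⊥) (i, ⊤)) (τ : Setoid (Option (Fin n))) :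
    σ (i, TT τ) (i, ⊤) := by
  have := finSetoid (Option (Fin n))
  induction τ using WellFoundedGT.induction with
  | _ τ ih =>
  by_cases hτ : ∀ x, τ (some x) none
  · have : τ = ⊤ := by
      rw [eq_top_iff]
      have h' : ∀ o, τ o none := by
        rintro (_ | x)
        · exact τ.refl' _
        · exact hτ x
      intro a b _
      exact τ.trans' (h' a) (τ.symm' (h' b))
    rw [this]
    unfold TT
    rw [EE_top]
    exact hσ.1.refl _
  push Not at hτ
  obtain ⟨x0, hx0⟩ := hτ
  let l : Quotient τ := Quotient.mk τ none
  let l2 : Quotient τ := Quotient.mk τ (some x0)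
  have hl : l ≠ l2 := fun h => hx0 (τ.symm' (Quotient.exact h))
  let u : Fin n → Quotient τ := fun x => Quotient.mk τ (some x)
  let e : Bool → Quotient τ := fun t => if t then l else l2
  have he : Function.Injective e := by
    rintro (_ | _) (_ | _) h
    · rfl
    · exact absurd h.symm hl
    · exact absurd h hl
    · rfl
  let m : Fin n → Quotient τ := e ∘ c
  let m2 : Fin n → Quotient τ := e ∘ d
  have hB : EE c d ⊥ = EE m m2 ⊥ := by
    ext x y
    rcases x with x | x <;> rcases y with y | y <;> exact he.eq_iff.symm
  have mr : ∀ t, ∃ z, m z = e t := fun t => (hc t).imp (fun z hz => congrArg e hz)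
  have mr2 : ∀ t, ∃ z, m2 z = e t := fun t => (hd t).imp (fun z hz => congrArg e hz)
  have P1 := EE_mul_bot u m m2 (fun x y h => by
    obtain ⟨z, hz⟩ := mr (d y)
    exact ⟨z, hz.trans h.symm⟩) (fun z => Or.inr (mr2 (c z)))
  have P2 := EE_mul_bot u m2 (fun _ => l) (fun x y h => by
    obtain ⟨z, hz⟩ := mr2 true
    exact ⟨z, hz.trans h.symm⟩) (fun z => by
    rcases hz : d z with _ | _
    · exact Or.inl ⟨x0, (congrArg e hz).symm⟩
    · exact Or.inr ⟨z, (congrArg e hz).symm⟩)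
  have hT : EE u (fun _ => l) ⊥ = TT τ := by
    ext x y
    have hq : ∀ a b, Quotient.mk τ a = Quotient.mk τ b ↔ τ a b := fun a b => Quotient.eq
    rcases x with x | x <;> rcases y with y | y
    · exact hq (some x) (some y)
    · exact hq (some x) none
    · exact hq none (some y)
    · exact hq none none
  let γ : PM n := EE u m ⊥
  let δ : PM n := EE m2 (fun _ => l) ⊥
  have MT := mul_top hn γ
  obtain ⟨z2, hz2⟩ := mr2 true
  let ρ : PM n := pmul (pmul γ ⊤) δ
  have mbt : ∀ z y, conn (pmul γ ⊤) δ (Sum.inr (Sum.inl z)) (Sum.inr (Sum.inr y)) := by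
    intro z y
    refine conn_trans (conn_l (α := pmul γ ⊤) δ (x := Sum.inr z) (y := Sum.inr z2) (MT.2 _ _)) ?_
    exact conn_r (pmul γ ⊤) (β := δ) (x := Sum.inl z2) (y := Sum.inr y) hz2
  have hPhi : Phi (pmul γ ⊤) δ = 0 := by
    apply Phi_zero
    intro z
    exact ⟨Sum.inr z, mbt z z⟩
  have ρ1 : ∀ y y', ρ (Sum.inr y) (Sum.inr y') := fun y y' =>
    conn_r (pmul γ ⊤) (β := δ) (x := Sum.inr y) (y := Sum.inr y') rfl
  have ρ2 : ∀ x t y, u x = e t → ρ (Sum.inl x) (Sum.inr y) := by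
    intro x t y hx
    obtain ⟨z, hz⟩ := mr t
    have h1 : conn γ ⊤ (Sum.inl x) (Sum.inr (Sum.inr y)) := conn_trans
      (conn_l (α := γ) ⊤ (x := Sum.inl x) (y := Sum.inr z) (hx.trans hz.symm))
      (conn_r γ (β := ⊤) (x := Sum.inl z) (y := Sum.inr y) trivial)
    exact conn_trans (conn_l (α := pmul γ ⊤) δ (x := Sum.inl x) (y := Sum.inr y) h1) (mbt y y)
  have ρ3 : ∀ x y, τ (some x) (some y) → ρ (Sum.inl x) (Sum.inl y) := by
    intro x y hxy
    have h1 : conn γ ⊤ (Sum.inl x) (Sum.inl y) :=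
      conn_l (α := γ) ⊤ (x := Sum.inl x) (y := Sum.inl y) (Quotient.sound hxy)
    exact conn_l (α := pmul γ ⊤) δ (x := Sum.inl x) (y := Sum.inl y) h1
  have h1 : σ (i, TT τ) (i, ρ) := by
    rw [hB] at h
    have a1 := cg_left hσ h γ P1.2 MT.1
    rw [P1.1] at a1
    have a2 := cg_right hσ a1 δ P2.2 hPhi
    rwa [P2.1, hT] at a2
  rw [TT_of hn ρ ρ1] at h1
  refine hσ.1.trans h1 (ih _ (lt_of_le_of_ne ?_ ?_))
  · rintro (_ | x) (_ | y) hxy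
    · exact ρ.refl' _
    · exact ρ.symm' (ρ2 y true _ (Quotient.sound (τ.symm' hxy)))
    · exact ρ2 x true _ (Quotient.sound hxy)
    · exact ρ3 x y hxy
  · intro heq
    apply hx0
    rw [heq]
    exact ρ2 x0 false _ rfl

theorem N_mul (hn : 1 ≤ n) : let N : PM n := EE (fun _ => true) (fun _ => false) ⊥
    pmul N N = N ∧ Phi N N = 1 ∧ pmul N ⊤ = N := by
  intro N
  let f : W n → Fin 3 := Sum.elim (fun _ => 0) (Sum.elim (fun _ => 1) (fun _ => 2))
  have hf : ∀ x y, conn N N x y → f x = f y := by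
    intro x y h
    refine conn_label f ?_ ?_ h
    · rintro (x | x) (y | y) h
      · rfl
      · exact absurd h (by decide : ¬ true = false)
      · exact absurd h (by decide : ¬ false = true)
      · rfl
    · rintro (x | x) (y | y) h
      · rfl
      · exact absurd h (by decide : ¬ true = false)
      · exact absurd h (by decide : ¬ false = true)
      · rfl
  have mm : ∀ x y, conn N N (Sum.inr (Sum.inl x)) (Sum.inr (Sum.inl y)) := fun x y =>
    conn_l (α := N) N (x := Sum.inr x) (y := Sum.inr y) rfl
  refine ⟨?_, ?_, ?_⟩
  · ext x y
    rcases x with x | x <;> rcases y with y | y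
    · exact ⟨fun _ => rfl, fun h => conn_l (α := N) N (x := Sum.inl x) (y := Sum.inl y) h⟩
    · exact ⟨fun h => absurd (hf _ _ h) (by decide : ¬ (0 : Fin 3) = 2),
        fun h => absurd h (by decide : ¬ true = false)⟩
    · exact ⟨fun h => absurd (hf _ _ h) (by decide : ¬ (2 : Fin 3) = 0),
        fun h => absurd h (by decide : ¬ false = true)⟩
    · exact ⟨fun _ => rfl, fun h => conn_r N (β := N) (x := Sum.inr x) (y := Sum.inr y) h⟩
  · unfold Phi
    rw [Nat.card_eq_one_iff_unique]
    constructor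
    · constructor
      rintro ⟨p, hp⟩ ⟨p', hp'⟩
      apply Subtype.ext
      induction p using Quotient.inductionOn with
      | h x =>
      induction p' using Quotient.inductionOn with
      | h y =>
      obtain ⟨k, rfl⟩ := hp x rfl
      obtain ⟨k', rfl⟩ := hp' y rfl
      exact Quotient.sound (mm k k')
    · refine ⟨⟨Quotient.mk _ (Sum.inr (Sum.inl ⟨0, hn⟩)), ?_⟩⟩
      intro x hx
      have h1 := hf _ _ (Quotient.exact hx)
      rcases x with x | x | x
      · exact absurd h1 (by decide : ¬ (0 : Fin 3) = 1)
      · exact ⟨x, rfl⟩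
      · exact absurd h1 (by decide : ¬ (2 : Fin 3) = 1)
  · let g : W n → Bool := Sum.elim (fun _ => true) (fun _ => false)
    have hg : ∀ x y, conn N ⊤ x y → g x = g y := by
      intro x y h
      refine conn_label g ?_ ?_ h
      · rintro (x | x) (y | y) h <;> exact h
      · rintro (x | x) (y | y) h <;> rfl
    ext x y
    rcases x with x | x <;> rcases y with y | y
    · exact ⟨fun _ => rfl, fun h => conn_l (α := N) ⊤ (x := Sum.inl x) (y := Sum.inl y) h⟩
    · exact ⟨fun h => hg _ _ h, fun h => absurd h (by decide : ¬ true = false)⟩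
    · exact ⟨fun h => hg _ _ h, fun h => absurd h (by decide : ¬ false = true)⟩
    · exact ⟨fun _ => rfl, fun h => conn_r N (β := ⊤) (x := Sum.inr x) (y := Sum.inr y) trivial⟩

theorem zeroL {σ : (ℕ × PM n) → (ℕ × PM n) → Prop} (hσ : IsCongruence (tmul (n := n)) σ)
    (hn : 1 ≤ n) {i : ℕ} (c d : Fin n → Bool) (hc : Function.Surjective c)
    (hd : Function.Surjective d) (h : σ (i, EE c d ⊥) (i, ⊤)) (a : ℕ × PM n) :
    σ (tmul a (i, ⊤)) (i, ⊤) := by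
  have T := TT_top hσ hn c d hc hd h
  have hN : (EE (fun _ => true) (fun _ => false) ⊥ : PM n) =
      TT (Setoid.ker Option.isSome) := by
    ext x y
    rcases x with x | x <;> rcases y with y | y <;> exact Iff.rfl
  obtain ⟨n1, n2, n3⟩ := N_mul hn
  have s1 : σ (1 + i, ⊤) (i, ⊤) := by
    have t1 := T (Setoid.ker Option.isSome)
    rw [← hN] at t1
    have t2 := (hσ.2 _ _ (0, EE (fun _ => true) (fun _ => false) ⊥) t1).1
    simp only [tmul, n1, n2, n3, (mul_top hn _).1] at t2
    have e1 : 0 + i + 1 = 1 + i := by omega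
    have e2 : 0 + i + 0 = i := by omega
    rw [e1, e2] at t2
    exact hσ.1.trans (hσ.1.symm (cg_tw hσ t1 1)) (hσ.1.trans t2 t1)
  have s2 : ∀ k, σ (k + i, ⊤) (i, ⊤) := by
    intro k
    induction k with
    | zero => rw [Nat.zero_add]; exact hσ.1.refl _
    | succ k ih =>
      have := cg_tw hσ s1 k
      rw [← Nat.add_assoc] at this
      exact hσ.1.trans this ih
  obtain ⟨k, s⟩ := a
  have M := mul_top hn s
  simp only [tmul, M.1]
  rw [TT_of hn _ M.2]
  exact hσ.1.trans (cg_tw hσ (T _) k) (s2 k)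

theorem fl_top : fl (⊤ : PM n) = ⊤ := by
  ext x y
  exact ⟨fun _ => trivial, fun _ => trivial⟩

theorem zeroR {σ : (ℕ × PM n) → (ℕ × PM n) → Prop} (hσ : IsCongruence (tmul (n := n)) σ)
    (hn : 1 ≤ n) {i : ℕ} (c d : Fin n → Bool) (hc : Function.Surjective c)
    (hd : Function.Surjective d) (h : σ (i, EE c d ⊥) (i, ⊤)) (a : ℕ × PM n) :
    σ (tmul (i, ⊤) a) (i, ⊤) := by
  have h' : σ (i, fl (EE d c ⊥)) (i, fl ⊤) := by
    rw [fl_EE, fl_top]; exact h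
  have := zeroL (cg_flip hσ) hn d c hd hc h' (a.1, fl a.2)
  simp only [tmul, fl_top, ← pmul_fl, fl_fl] at this
  have e : Phi (fl a.2) ⊤ = Phi ⊤ a.2 := by
    rw [← Phi_fl (⊤ : PM n) a.2, fl_top]
  rw [e, add_comm a.1] at this
  exact this

/-- `(i,α)` is related to a zero. -/
theorem core {σ : (ℕ × PM n) → (ℕ × PM n) → Prop} (hσ : IsCongruence (tmul (n := n)) σ)
    (hn : 1 ≤ n) {i j : ℕ} {α β : PM n} (h : σ (i, α) (j, β)) (h2 : 2 ≤ rnk α)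
    (hc : Cond α β) :
    σ (i, α) (i, ⊤) ∧ ∀ a, σ (tmul a (i, ⊤)) (i, ⊤) ∧ σ (tmul (i, ⊤) a) (i, ⊤) := by
  obtain ⟨y, y', hy, h1⟩ := C1 hσ h h2 hc
  obtain ⟨c, d, a, b, hca, hdb, k, l, hkl, h3⟩ := C3 hσ h2 y y' hy h1
  have sc : Function.Surjective c := fun k => ⟨_, hca k⟩
  have sd : Function.Surjective d := fun k => ⟨_, hdb k⟩
  have h4 := C4 hσ c d sc sd k l hkl h3
  obtain ⟨c', d', sc', sd', h5⟩ := C5 hσ h2 c d sc sd h4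
  have Z : ∀ a, σ (tmul a (i, ⊤)) (i, ⊤) ∧ σ (tmul (i, ⊤) a) (i, ⊤) := fun a =>
    ⟨zeroL hσ hn c' d' sc' sd' h5 a, zeroR hσ hn c' d' sc' sd' h5 a⟩
  refine ⟨?_, Z⟩
  have hr : rnk α ≤ rnk (EE c d ⊥) := rnk_ge a b (fun k => (hca k).trans (hdb k).symm)
    (fun k l h => (hca k).symm.trans (Eq.trans h (hca l)))
  obtain ⟨γ, δ, p1, p2, p3⟩ := J_lemma hn (EE c d ⊥) α hr
  have q1 := (hσ.2 _ _ (0, γ) h4).1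
  have q2 := (hσ.2 _ _ (0, δ) (hσ.1.trans q1 (Z _).1)).2
  have q3 := hσ.1.trans q2 (Z _).2
  simpa [tmul, p1, p2, p3] using q3

theorem tmul_fl (a x : ℕ × PM n) : ((tmul a x).1, fl (tmul a x).2) =
    tmul (x.1, fl x.2) (a.1, fl a.2) := by
  simp only [tmul, pmul_fl, Phi_fl]
  rw [add_comm a.1]

theorem core_fl {σ : (ℕ × PM n) → (ℕ × PM n) → Prop} (hσ : IsCongruence (tmul (n := n)) σ)
    (hn : 1 ≤ n) {i j : ℕ} {α β : PM n} (h : σ (i, α) (j, β)) (h2 : 2 ≤ rnk α)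
    (hc : Cond (fl α) (fl β)) :
    σ (i, α) (i, ⊤) ∧ ∀ a, σ (tmul a (i, ⊤)) (i, ⊤) ∧ σ (tmul (i, ⊤) a) (i, ⊤) := by
  have h' : σ (i, fl (fl α)) (j, fl (fl β)) := by rwa [fl_fl, fl_fl]
  obtain ⟨z, hz⟩ := core (cg_flip hσ) hn (α := fl α) (β := fl β) h'
    (by rwa [rnk_fl]) hc
  constructor
  · simpa only [fl_fl, fl_top] using z
  · intro a
    have := hz (a.1, fl a.2)
    simp only [tmul_fl, fl_fl, fl_top] at this
    exact ⟨this.2, this.1⟩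

theorem not_cond {α β : PM n} (h : ¬ Cond α β) :
    (∀ b b', β (Sum.inr b) (Sum.inr b') → α (Sum.inr b) (Sum.inr b')) ∧
    ∀ p, (∃ a, α (Sum.inl a) (Sum.inr p)) → ∃ a, β (Sum.inl a) (Sum.inr p) := by
  have k : ∀ b b', β (Sum.inr b) (Sum.inr b') → α (Sum.inr b) (Sum.inr b') := by
    intro b b' hb
    by_contra hα
    exact h (Or.inl ⟨b, b', hb, hα⟩)
  refine ⟨k, fun p hp => ?_⟩
  by_contra hβ
  exact h (Or.inr ⟨k, p, hp, hβ⟩)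

theorem rnk_le_of_not_cond {α β : PM n} (h : ¬ Cond α β) : rnk α ≤ rnk β := by
  obtain ⟨k, hcod⟩ := not_cond h
  obtain ⟨a, b, r1, r2, _⟩ := rnk_reps α
  choose a' ha' using fun l => hcod (b l) ⟨a l, r1 l⟩
  refine rnk_ge a' b ha' (fun s t hst => ?_)
  apply r2
  exact α.trans' (r1 s) (α.trans' (k _ _ (β.trans' (β.symm' (ha' s)) (β.trans' hst (ha' t))))
    (α.symm' (r1 t)))

theorem greenR_of_not_cond {α β : PM n} (h : ¬ Cond α β) (h' : ¬ Cond β α) :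
    greenR pmul (fl α) (fl β) := by
  obtain ⟨k, c⟩ := not_cond h
  obtain ⟨k', c'⟩ := not_cond h'
  have key : ∀ α β : PM n, (∀ p, (∃ a, α (Sum.inl a) (Sum.inr p)) → ∃ a, β (Sum.inl a) (Sum.inr p))
      → ∀ x, (∃ y, fl α (Sum.inl x) (Sum.inr y)) → ∃ y, fl β (Sum.inl x) (Sum.inr y) := by
    rintro α β h x ⟨y, hy⟩
    have hy' : α (Sum.inr x) (Sum.inl y) := hy
    obtain ⟨z, hz⟩ := h x ⟨y, α.symm' hy'⟩
    exact ⟨z, β.symm' hz⟩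
  exact greenR_of (fun x y => ⟨k' x y, k x y⟩) (fun x => ⟨key α β c x, key β α c' x⟩)

theorem finish {σ : (ℕ × PM n) → (ℕ × PM n) → Prop} (hσ : IsCongruence (tmul (n := n)) σ)
    (hn : 1 ≤ n) {i j q r : ℕ} {α β : PM n} (hq : rnk α = q) (hr : rnk β = r) (z : ℕ × PM n)
    (h1 : σ (i, α) z) (h2 : σ (j, β) z) (hz : ∀ a, σ (tmul a z) z ∧ σ (tmul z a) z) :
    ({b : ℕ × PM n | i ≤ b.1 ∧ rnk b.2 ≤ q} ∪ {b : ℕ × PM n | j ≤ b.1 ∧ rnk b.2 ≤ r})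
      ⊆ Isig n σ := by
  have hl : ∀ a x, σ x z → σ (tmul a x) z := fun a x hx =>
    hσ.1.trans (hσ.2 _ _ a hx).1 (hz a).1
  have hrr : ∀ a x, σ x z → σ (tmul x a) z := fun a x hx =>
    hσ.1.trans (hσ.2 _ _ a hx).2 (hz a).2
  have key : ∀ (i : ℕ) (α : PM n), σ (i, α) z → ∀ b : ℕ × PM n, i ≤ b.1 → rnk b.2 ≤ rnk α →
      σ b z := by
    rintro i α h ⟨k, ρ⟩ hk hρ
    obtain ⟨γ, δ, p1, p2, p3⟩ := J_lemma hn α ρ hρ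
    have s1 := hl (k - i, ext ⊥) _ h
    rw [tw_eq, Nat.sub_add_cancel hk] at s1
    have s2 := hrr (0, δ) _ (hl (0, γ) _ s1)
    simpa [tmul, p1, p2, p3] using s2
  intro b hb
  refine Set.mem_sUnion.2 ⟨{x | σ x z}, ⟨?_, ?_⟩, ?_⟩
  · intro a c x hx
    exact hrr c _ (hl a _ hx)
  · rintro x y (rfl | ⟨hx, hy⟩)
    · exact hσ.1.refl _
    · exact hσ.1.trans hx (hσ.1.symm hy)
  · rcases hb with ⟨hb1, hb2⟩ | ⟨hb1, hb2⟩
    · exact key i α h1 b hb1 (hq ▸ hb2)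
    · exact key j β h2 b hb1 (hr ▸ hb2)

/-- If a congruence `σ` on `P_n^Φ` relates `(i,α) ∈ D_{qi}` and
`(j,β) ∈ D_{rj}` with `q ≥ r`, `q ≥ 2` and `α` not H-related to `β`, then
`I_{qi} ∪ I_{rj} ⊆ I(σ)`. -/
theorem ideals_in_Isig (n : ℕ) (hn : 1 ≤ n)
    (σ : (ℕ × PM n) → (ℕ × PM n) → Prop) (hσ : IsCongruence (tmul (n := n)) σ)
    (i j q r : ℕ) (α β : PM n) (h : σ (i, α) (j, β))
    (hq : rnk α = q) (hr : rnk β = r) (hrq : r ≤ q) (h2 : 2 ≤ q)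
    (hH : ¬ greenH (pmul (n := n)) α β) :
    ({b : ℕ × PM n | i ≤ b.1 ∧ rnk b.2 ≤ q} ∪ {b : ℕ × PM n | j ≤ b.1 ∧ rnk b.2 ≤ r})
      ⊆ Isig n σ := by
  classical
  have fin := finish (i := i) (j := j) hσ hn hq hr
  by_cases c1 : Cond α β
  · obtain ⟨z, hz⟩ := core hσ hn h (hq ▸ h2) c1
    exact fin _ z (hσ.1.trans (hσ.1.symm h) z) hz
  have hle := rnk_le_of_not_cond c1
  have h2' : 2 ≤ rnk β := by omega
  by_cases c2 : Cond β α
  · obtain ⟨z, hz⟩ := core hσ hn (hσ.1.symm h) h2' c2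
    exact fin _ (hσ.1.trans h z) z hz
  by_cases c3 : Cond (fl α) (fl β)
  · obtain ⟨z, hz⟩ := core_fl hσ hn h (hq ▸ h2) c3
    exact fin _ z (hσ.1.trans (hσ.1.symm h) z) hz
  by_cases c4 : Cond (fl β) (fl α)
  · obtain ⟨z, hz⟩ := core_fl hσ hn (hσ.1.symm h) h2' c4
    exact fin _ (hσ.1.trans h z) z hz
  exfalso
  apply hH
  have g1 := greenR_of_not_cond c3 c4
  rw [fl_fl, fl_fl] at g1
  exact ⟨g1, greenL_of_fl (greenR_of_not_cond c1 c2)⟩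

end TPM
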